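/- arXiv:1605.06389 — 6 statements merged into one kernel-verified Lean document; each statement's English description precedes it below -/
import Mathlib

section
/- Let 1 ≤ N ≤ n be integers, let 1 < p < ∞, let α, β ∈ ℝ and set γ = α + β + 1. Then for every complex-valued function f ∈ C_0^∞(ℝⁿ \ {x' = 0}) one has (|N − γ|/p) ∫_{ℝⁿ} |f(x)|^p / |x'|^γ dx ≤ (∫_{ℝⁿ} |∇f(x)|^p / |x'|^{αp} dx)^{1/p} · (∫_{ℝⁿ} |f(x)|^p / |x'|^{βp/(p−1)} dx)^{(p−1)/p}, where ∇ is the full gradient on ℝⁿ. -/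
open MeasureTheory

/-- The Euclidean norm of `x' = (x_1, …, x_N)`, the first `N` coordinates of `x ∈ ℝⁿ`. -/
noncomputable def sliceNorm {n : ℕ} (N : ℕ) (h : N ≤ n) (x : EuclideanSpace ℝ (Fin n)) : ℝ :=
  Real.sqrt (∑ i : Fin N, (x (Fin.castLE h i)) ^ 2)

section SliceNorm

variable {n N : ℕ} (hNn : N ≤ n)

local notation "𝔼" => EuclideanSpace ℝ (Fin n)

theorem sliceNorm_nonneg (x : 𝔼) : 0 ≤ sliceNorm N hNn x := Real.sqrt_nonneg _

theorem sliceNorm_sq (x : 𝔼) :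
    sliceNorm N hNn x ^ 2 = ∑ i : Fin N, x (Fin.castLE hNn i) ^ 2 :=
  Real.sq_sqrt (Finset.sum_nonneg fun _ _ => sq_nonneg _)

theorem sliceNorm_ne_zero_of_exists {x : 𝔼} (hx : ∃ i : Fin N, x (Fin.castLE hNn i) ≠ 0) :
    sliceNorm N hNn x ≠ 0 := by
  obtain ⟨i, hi⟩ := hx
  have h : 0 < sliceNorm N hNn x ^ 2 := by
    rw [sliceNorm_sq]
    exact Finset.sum_pos' (fun _ _ => sq_nonneg _) ⟨i, Finset.mem_univ i, by positivity⟩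
  intro h0
  simp [h0] at h

/-- The orthogonal projection of `x = (x', x'')` onto the first factor, as a vector `(x', 0)`. -/
noncomputable def sliceVector (x : 𝔼) : 𝔼 :=
  ∑ i : Fin N, x (Fin.castLE hNn i) • EuclideanSpace.single (Fin.castLE hNn i) (1 : ℝ)

theorem norm_sliceVector (x : 𝔼) : ‖sliceVector hNn x‖ = sliceNorm N hNn x := by
  have ho : Orthonormal ℝ fun i : Fin N => EuclideanSpace.single (Fin.castLE hNn i) (1 : ℝ) := by
    have := (EuclideanSpace.basisFun (Fin n) ℝ).orthonormal.comp _ (Fin.castLE_injective hNn)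
    simpa [Function.comp_def] using this
  refine (sq_eq_sq₀ (norm_nonneg _) (sliceNorm_nonneg hNn x)).1 ?_
  rw [sliceNorm_sq, ← real_inner_self_eq_norm_sq, sliceVector, ho.inner_sum]
  simp [sq]

theorem contDiffAt_sliceNorm_rpow {x : 𝔼} (hx : sliceNorm N hNn x ≠ 0) (a : ℝ) {k : ℕ∞} :
    ContDiffAt ℝ k (fun y => sliceNorm N hNn y ^ a) x := by
  refine ContDiffAt.rpow_const_of_ne (ContDiffAt.sqrt ?_ ?_) hx
  · exact ContDiff.contDiffAt (by fun_prop)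
  · intro h
    exact hx (by simp [sliceNorm, h])

theorem fderiv_sliceNorm_rpow_single {x : 𝔼} (hx : sliceNorm N hNn x ≠ 0) (a : ℝ) (i : Fin N) :
    fderiv ℝ (fun y => sliceNorm N hNn y ^ a) x (EuclideanSpace.single (Fin.castLE hNn i) 1) =
      a * sliceNorm N hNn x ^ (a - 2) * x (Fin.castLE hNn i) := by
  have hs : HasFDerivAt (fun y : 𝔼 => ∑ j : Fin N, y (Fin.castLE hNn j) ^ 2)
      (∑ j : Fin N, (2 * x (Fin.castLE hNn j)) •
        (EuclideanSpace.proj (Fin.castLE hNn j) : 𝔼 →L[ℝ] ℝ)) x := by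
    refine HasFDerivAt.fun_sum fun j _ => ?_
    have := ((EuclideanSpace.proj (Fin.castLE hNn j) : 𝔼 →L[ℝ] ℝ).hasFDerivAt (x := x)).pow 2
    simpa using this
  have hs0 : ∑ j : Fin N, x (Fin.castLE hNn j) ^ 2 ≠ 0 := by
    rw [← sliceNorm_sq]; exact pow_ne_zero 2 hx
  have hw := (hs.sqrt hs0).rpow_const (p := a) (Or.inl hx)
  have hsum : ∑ j : Fin N, 2 * x (Fin.castLE hNn j) *
      (EuclideanSpace.single (Fin.castLE hNn i) (1 : ℝ) : 𝔼) (Fin.castLE hNn j) =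
      2 * x (Fin.castLE hNn i) := by
    rw [Finset.sum_eq_single i] <;> simp +contextual
  have hr : sliceNorm N hNn x ^ (a - 1) = sliceNorm N hNn x ^ (a - 2) * sliceNorm N hNn x := by
    rw [← Real.rpow_add_one hx]; ring_nf
  change fderiv ℝ (fun y : 𝔼 => √(∑ j : Fin N, y (Fin.castLE hNn j) ^ 2) ^ a) x _ = _
  rw [hw.fderiv]
  change (a * sliceNorm N hNn x ^ (a - 1)) • ((1 / (2 * sliceNorm N hNn x)) •
    ((∑ j : Fin N, (2 * x (Fin.castLE hNn j)) •
      (EuclideanSpace.proj (Fin.castLE hNn j) : 𝔼 →L[ℝ] ℝ)) _)) = _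
  simp only [sum_apply, smul_apply, PiLp.proj_apply, smul_eq_mul]
  rw [hsum, hr]
  field_simp

/-- Multiplying a function supported away from `{x' = 0}` by a power of `|x'|` keeps it smooth. -/
theorem ContDiff.mul_sliceNorm_rpow {k : ℕ∞} {g : 𝔼 → ℝ} (hg : ContDiff ℝ k g)
    (hgs : ∀ x ∈ tsupport g, sliceNorm N hNn x ≠ 0) (a : ℝ) :
    ContDiff ℝ k fun x => g x * sliceNorm N hNn x ^ a := by
  rw [contDiff_iff_contDiffAt]
  intro x
  by_cases hx : x ∈ tsupport g
  · exact hg.contDiffAt.mul (contDiffAt_sliceNorm_rpow hNn (hgs x hx) a)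
  · refine (contDiffAt_const (c := (0 : ℝ))).congr_of_eventuallyEq ?_
    filter_upwards [notMem_tsupport_iff_eventuallyEq.1 hx] with y hy
    simp [hy]

theorem Continuous.mul_sliceNorm_rpow {g : 𝔼 → ℝ} (hg : Continuous g)
    (hgs : ∀ x ∈ tsupport g, sliceNorm N hNn x ≠ 0) (a : ℝ) :
    Continuous fun x => g x * sliceNorm N hNn x ^ a :=
  contDiff_zero.1 (ContDiff.mul_sliceNorm_rpow (k := 0) hNn (contDiff_zero.2 hg) hgs a)

theorem integral_fderiv_apply_eq_zero {h : 𝔼 → ℝ} (hh : ContDiff ℝ 1 h)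
    (hc : HasCompactSupport h) (v : 𝔼) : ∫ x, fderiv ℝ h x v = 0 := by
  have hi : Integrable fun x => fderiv ℝ h x v :=
    ((hh.continuous_fderiv one_ne_zero).clm_apply continuous_const).integrable_of_hasCompactSupport
      (hc.fderiv_apply ℝ v)
  have := integral_mul_fderiv_eq_neg_fderiv_mul_of_integrable (μ := volume) (𝕜 := ℝ)
    (f := fun _ : 𝔼 => (1 : ℝ)) (g := h) (v := v) (by simp) (by simpa using hi)
    (by simpa using hh.continuous.integrable_of_hasCompactSupport hc)
    (fun x _ => differentiableAt_const _) (fun x _ => hh.differentiable one_ne_zero x)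
  simpa using this

theorem sum_fderiv_mul_sliceNorm_rpow {g : 𝔼 → ℝ} (hg : ContDiff ℝ 1 g)
    (hgs : ∀ x ∈ tsupport g, sliceNorm N hNn x ≠ 0) (a : ℝ) (x : 𝔼) :
    ∑ i : Fin N, fderiv ℝ (fun y => g y * sliceNorm N hNn y ^ a * y (Fin.castLE hNn i)) x
        (EuclideanSpace.single (Fin.castLE hNn i) 1) =
      (N + a) * (g x * sliceNorm N hNn x ^ a) +
        fderiv ℝ g x (sliceVector hNn x) * sliceNorm N hNn x ^ a := by
  by_cases hx : x ∈ tsupport g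
  · have hr := hgs x hx
    have hterm : ∀ i : Fin N,
        fderiv ℝ (fun y => g y * sliceNorm N hNn y ^ a * y (Fin.castLE hNn i)) x
          (EuclideanSpace.single (Fin.castLE hNn i) 1) =
        g x * sliceNorm N hNn x ^ a +
          g x * (a * sliceNorm N hNn x ^ (a - 2)) * x (Fin.castLE hNn i) ^ 2 +
          x (Fin.castLE hNn i) * fderiv ℝ g x (EuclideanSpace.single (Fin.castLE hNn i) 1) *
            sliceNorm N hNn x ^ a := by
      intro i
      have h1 : HasFDerivAt g (fderiv ℝ g x) x := (hg.differentiable one_ne_zero x).hasFDerivAt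
      have h2 := ((contDiffAt_sliceNorm_rpow (k := 1) hNn hr a).differentiableAt
        one_ne_zero).hasFDerivAt
      have h3 := (EuclideanSpace.proj (Fin.castLE hNn i) : 𝔼 →L[ℝ] ℝ).hasFDerivAt (x := x)
      have h := ((h1.mul h2).mul h3).fderiv
      have h' := congrArg (fun L => L (EuclideanSpace.single (Fin.castLE hNn i) (1 : ℝ))) h
      refine h'.trans ?_
      simp [fderiv_sliceNorm_rpow_single hNn hr]
      ring
    have hp : sliceNorm N hNn x ^ (a - 2) * sliceNorm N hNn x ^ 2 = sliceNorm N hNn x ^ a := by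
      rw [← Real.rpow_add_natCast hr]; norm_num
    rw [Finset.sum_congr rfl fun i _ => hterm i, Finset.sum_add_distrib, Finset.sum_add_distrib,
      ← Finset.mul_sum _ _ (g x * (a * sliceNorm N hNn x ^ (a - 2))),
      ← sliceNorm_sq, sliceVector, map_sum]
    simp only [map_smul, smul_eq_mul, Finset.sum_const, Finset.card_univ, Fintype.card_fin,
      nsmul_eq_mul, Finset.sum_mul]
    linear_combination g x * a * hp
  · have h0 : g x = 0 := image_eq_zero_of_notMem_tsupport hx
    rw [fderiv_of_notMem_tsupport ℝ hx, h0, Finset.sum_eq_zero]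
    · simp
    · intro i _
      rw [fderiv_of_notMem_tsupport, zero_apply]
      refine fun h => hx (closure_mono ?_ h)
      intro y hy hgy
      simp [hgy] at hy

theorem continuous_sliceVector : Continuous (sliceVector (n := n) hNn) := by
  unfold sliceVector
  fun_prop

/-- Integration by parts against the vector field `|x'|^a (x', 0)`. -/
theorem integral_mul_sliceNorm_rpow {g : 𝔼 → ℝ} (hg : ContDiff ℝ 1 g)
    (hc : HasCompactSupport g) (hgs : ∀ x ∈ tsupport g, sliceNorm N hNn x ≠ 0) (a : ℝ) :
    (N + a) * ∫ x, g x * sliceNorm N hNn x ^ a =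
      -∫ x, fderiv ℝ g x (sliceVector hNn x) * sliceNorm N hNn x ^ a := by
  have hC : ∀ i : Fin N, ContDiff ℝ 1
      fun y => g y * sliceNorm N hNn y ^ a * y (Fin.castLE hNn i) := fun i =>
    (ContDiff.mul_sliceNorm_rpow (k := 1) hNn hg hgs a).mul (by fun_prop)
  have hS : ∀ i : Fin N, HasCompactSupport
      fun y => g y * sliceNorm N hNn y ^ a * y (Fin.castLE hNn i) := fun i =>
    hc.mul_right.mul_right
  have hsub : tsupport (fun x => fderiv ℝ g x (sliceVector hNn x)) ⊆ tsupport g :=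
    closure_minimal (fun x hx => by
      by_contra h
      simp [fderiv_of_notMem_tsupport ℝ h] at hx) isClosed_closure
  have hi1 : Integrable fun x => g x * sliceNorm N hNn x ^ a :=
    (hg.continuous.mul_sliceNorm_rpow hNn hgs a).integrable_of_hasCompactSupport hc.mul_right
  have hcd : HasCompactSupport fun x => fderiv ℝ g x (sliceVector hNn x) :=
    hc.of_isClosed_subset isClosed_closure hsub
  have hi2 : Integrable fun x => fderiv ℝ g x (sliceVector hNn x) * sliceNorm N hNn x ^ a :=
    (Continuous.mul_sliceNorm_rpow hNn ((hg.continuous_fderiv one_ne_zero).clm_apply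
      (continuous_sliceVector hNn)) (fun x hx => hgs x (hsub hx)) a).integrable_of_hasCompactSupport
      hcd.mul_right
  have key : ∫ x, ∑ i : Fin N,
      fderiv ℝ (fun y => g y * sliceNorm N hNn y ^ a * y (Fin.castLE hNn i)) x
        (EuclideanSpace.single (Fin.castLE hNn i) 1) = 0 := by
    rw [integral_finsetSum]
    · exact Finset.sum_eq_zero fun i _ => integral_fderiv_apply_eq_zero (hC i) (hS i) _
    · intro i _
      exact (((hC i).continuous_fderiv one_ne_zero).clm_apply
        continuous_const).integrable_of_hasCompactSupport ((hS i).fderiv_apply ℝ _)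
  simp_rw [sum_fderiv_mul_sliceNorm_rpow hNn hg hgs a] at key
  rw [integral_add (hi1.const_mul _) hi2, integral_const_mul] at key
  linarith

end SliceNorm

/-- Horizontal `L^p`-Caffarelli–Kohn–Nirenberg type inequality on `ℝⁿ = ℝ^N × ℝ^{n-N}`. -/
theorem stmt0 (n N : ℕ) (hN : 1 ≤ N) (hNn : N ≤ n) (p α β γ : ℝ) (hp1 : 1 < p)
    (hγ : γ = α + β + 1)
    (f : EuclideanSpace ℝ (Fin n) → ℂ) (hf : ContDiff ℝ (⊤ : ℕ∞) f)
    (hfc : HasCompactSupport f)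
    (hfs : tsupport f ⊆ {x | ∃ i : Fin N, x (Fin.castLE hNn i) ≠ 0}) :
    (|(N : ℝ) - γ| / p) * ∫ x, ‖f x‖ ^ p / sliceNorm N hNn x ^ γ
      ≤ (∫ x, ‖fderiv ℝ f x‖ ^ p / sliceNorm N hNn x ^ (α * p)) ^ (1 / p) *
        (∫ x, ‖f x‖ ^ p / sliceNorm N hNn x ^ (β * p / (p - 1))) ^ ((p - 1) / p) := by
  have hp0 : 0 < p := by linarith
  have hr0 : ∀ x, 0 ≤ sliceNorm N hNn x := sliceNorm_nonneg hNn
  have hfr : ∀ x ∈ tsupport f, sliceNorm N hNn x ≠ 0 := fun x hx =>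
    sliceNorm_ne_zero_of_exists hNn (hfs hx)
  have hf1 : ContDiff ℝ 1 f := hf.of_le (by exact_mod_cast le_top)
  have hsupp : ∀ s : ℝ, s ≠ 0 → tsupport (fun x => ‖f x‖ ^ s) ⊆ tsupport f := fun s hs =>
    closure_mono fun x hx h => hx (by simp [h, Real.zero_rpow hs])
  have hsuppd : tsupport (fun x => ‖fderiv ℝ f x‖) ⊆ tsupport f :=
    tsupport_comp_subset norm_zero _ |>.trans (tsupport_fderiv_subset ℝ)
  have hcpt : ∀ {g : EuclideanSpace ℝ (Fin n) → ℝ}, tsupport g ⊆ tsupport f →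
      HasCompactSupport g := fun h => hfc.of_isClosed_subset isClosed_closure h
  set A : EuclideanSpace ℝ (Fin n) → ℝ := fun x => ‖fderiv ℝ f x‖ * sliceNorm N hNn x ^ (-α)
    with hA
  set B : EuclideanSpace ℝ (Fin n) → ℝ := fun x => ‖f x‖ ^ (p - 1) * sliceNorm N hNn x ^ (-β)
    with hB
  have hA0 : ∀ x, 0 ≤ A x := fun x => mul_nonneg (norm_nonneg _) (Real.rpow_nonneg (hr0 x) _)
  have hB0 : ∀ x, 0 ≤ B x := fun x =>
    mul_nonneg (Real.rpow_nonneg (norm_nonneg _) _) (Real.rpow_nonneg (hr0 x) _)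
  have hAc : Continuous A := Continuous.mul_sliceNorm_rpow hNn
    (hf1.continuous_fderiv one_ne_zero).norm (fun x hx => hfr x (hsuppd hx)) _
  have hBc : Continuous B := Continuous.mul_sliceNorm_rpow hNn
    (hf1.continuous.norm.rpow_const fun _ => Or.inr (by linarith))
    (fun x hx => hfr x (hsupp (p - 1) (by linarith) hx)) _
  have hAs : HasCompactSupport A := (hcpt hsuppd).mul_right
  have hBs : HasCompactSupport B := (hcpt (hsupp (p - 1) (by linarith))).mul_right
  have hHolder := integral_mul_le_Lp_mul_Lq_of_nonneg (μ := volume)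
    (Real.HolderConjugate.conjExponent hp1) (Filter.Eventually.of_forall hA0)
    (Filter.Eventually.of_forall hB0) (hAc.memLp_of_hasCompactSupport hAs)
    (hBc.memLp_of_hasCompactSupport hBs)
  have hAp : ∀ x, A x ^ p = ‖fderiv ℝ f x‖ ^ p / sliceNorm N hNn x ^ (α * p) := fun x => by
    rw [hA, Real.mul_rpow (norm_nonneg _) (Real.rpow_nonneg (hr0 x) _), ← Real.rpow_mul (hr0 x),
      neg_mul, Real.rpow_neg (hr0 x), div_eq_mul_inv]
  have hBq : ∀ x, B x ^ p.conjExponent =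
      ‖f x‖ ^ p / sliceNorm N hNn x ^ (β * p / (p - 1)) := fun x => by
    have h1 : (p - 1) * (p / (p - 1)) = p := mul_div_cancel₀ p (by linarith)
    rw [hB, Real.mul_rpow (Real.rpow_nonneg (norm_nonneg _) _) (Real.rpow_nonneg (hr0 x) _),
      ← Real.rpow_mul (hr0 x), ← Real.rpow_mul (norm_nonneg _), Real.conjExponent, h1,
      neg_mul, Real.rpow_neg (hr0 x), mul_div_assoc, ← div_eq_mul_inv]
  have hq : 1 / p.conjExponent = (p - 1) / p := by rw [Real.conjExponent, one_div_div]
  simp_rw [hAp, hBq, hq] at hHolder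
  refine le_trans ?_ hHolder
  have hg := hf1.norm_rpow hp1
  have hibp := integral_mul_sliceNorm_rpow hNn hg (hcpt (hsupp p hp0.ne'))
    (fun x hx => hfr x (hsupp p hp0.ne' hx)) (-γ)
  have hpt : ∀ x, ‖fderiv ℝ (fun y => ‖f y‖ ^ p) x (sliceVector hNn x) *
      sliceNorm N hNn x ^ (-γ)‖ ≤ p * (A x * B x) := fun x => by
    have hle : ‖fderiv ℝ (fun y => ‖f y‖ ^ p) x (sliceVector hNn x)‖ ≤
        p * ‖f x‖ ^ (p - 1) * ‖fderiv ℝ f x‖ * sliceNorm N hNn x := by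
      refine (ContinuousLinearMap.le_opNorm _ _).trans ?_
      rw [norm_sliceVector]
      exact mul_le_mul_of_nonneg_right
        (norm_fderiv_norm_rpow_le (hf1.differentiable one_ne_zero) hp1) (hr0 x)
    rw [norm_mul, Real.norm_of_nonneg (Real.rpow_nonneg (hr0 x) (-γ))]
    refine (mul_le_mul_of_nonneg_right hle (Real.rpow_nonneg (hr0 x) _)).trans_eq ?_
    by_cases hx : x ∈ tsupport f
    · have hr := (hr0 x).lt_of_ne' (hfr x hx)
      have he : sliceNorm N hNn x * sliceNorm N hNn x ^ (-γ) =
          sliceNorm N hNn x ^ (-α) * sliceNorm N hNn x ^ (-β) := by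
        rw [← Real.rpow_add hr, mul_comm, ← Real.rpow_add_one hr.ne', hγ]
        ring_nf
      simp only [hA, hB]
      linear_combination (p * ‖f x‖ ^ (p - 1) * ‖fderiv ℝ f x‖) * he
    · simp [hA, hB, fderiv_of_notMem_tsupport ℝ hx]
  have hint : Integrable fun x => p * (A x * B x) :=
    ((hAc.mul hBc).integrable_of_hasCompactSupport hAs.mul_right).const_mul p
  have hI := norm_integral_le_of_norm_le hint (Filter.Eventually.of_forall hpt)
  rw [← norm_neg, ← hibp, integral_const_mul, norm_mul, Real.norm_eq_abs, Real.norm_of_nonneg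
    (integral_nonneg fun x => mul_nonneg (Real.rpow_nonneg (norm_nonneg _) _)
      (Real.rpow_nonneg (hr0 x) _)), ← sub_eq_add_neg] at hI
  have hdiv : ∀ x, ‖f x‖ ^ p / sliceNorm N hNn x ^ γ =
      ‖f x‖ ^ p * sliceNorm N hNn x ^ (-γ) := fun x => by
    rw [Real.rpow_neg (hr0 x), div_eq_mul_inv]
  simp_rw [hdiv]
  rw [div_mul_eq_mul_div, div_le_iff₀ hp0, mul_comm _ p]
  exact hI
end

section
/- Let 1 ≤ N ≤ n be integers, let 1 < p < ∞ and α ∈ ℝ. Then for every complex-valued f ∈ C_0^∞(ℝⁿ \ {x' = 0}) one has (|N − p(α+1)|/p) · (∫_{ℝⁿ} |f(x)|^p / |x'|^{(α+1)p} dx)^{1/p} ≤ (∫_{ℝⁿ} |∇f(x)|^p / |x'|^{αp} dx)^{1/p}. -/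
open MeasureTheory

open Real in
theorem Real.div_rpow_mul_eq_mul_rpow_neg_rpow {a r : ℝ} (ha : 0 ≤ a) (hr : 0 ≤ r) (b p : ℝ) :
    a ^ p / r ^ (b * p) = (a * r ^ (-b)) ^ p := by
  rw [mul_rpow ha (rpow_nonneg hr _), ← rpow_mul hr, neg_mul, rpow_neg hr, div_eq_mul_inv]

section SliceNorm

variable {n N : ℕ} (h : N ≤ n)

theorem sliceNorm_nonneg_s2 (x : EuclideanSpace ℝ (Fin n)) : 0 ≤ sliceNorm N h x :=
  Real.sqrt_nonneg _

theorem sliceNorm_pos {x : EuclideanSpace ℝ (Fin n)} (hx : ∃ i : Fin N, x (Fin.castLE h i) ≠ 0) :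
    0 < sliceNorm N h x := by
  obtain ⟨i, hi⟩ := hx
  exact Real.sqrt_pos.2 (Finset.sum_pos' (fun _ _ ↦ sq_nonneg _)
    ⟨i, Finset.mem_univ i, by positivity⟩)

theorem sq_sliceNorm (x : EuclideanSpace ℝ (Fin n)) :
    sliceNorm N h x ^ 2 = ∑ i : Fin N, x (Fin.castLE h i) ^ 2 :=
  Real.sq_sqrt (Finset.sum_nonneg fun _ _ ↦ sq_nonneg _)

/-- The vector `(x', 0)`, where `x'` consists of the first `N` coordinates of `x`. -/
noncomputable def sliceProj (x : EuclideanSpace ℝ (Fin n)) : EuclideanSpace ℝ (Fin n) :=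
  ∑ i : Fin N, x (Fin.castLE h i) • EuclideanSpace.single (Fin.castLE h i) (1 : ℝ)

theorem sliceProj_apply_castLE (x : EuclideanSpace ℝ (Fin n)) (i : Fin N) :
    sliceProj h x (Fin.castLE h i) = x (Fin.castLE h i) := by
  simp [sliceProj, Pi.single_apply]

theorem norm_sliceProj (x : EuclideanSpace ℝ (Fin n)) : ‖sliceProj h x‖ = sliceNorm N h x := by
  have ho : Orthonormal ℝ fun i : Fin N ↦ EuclideanSpace.single (Fin.castLE h i) (1 : ℝ) :=
    (EuclideanSpace.orthonormal_single (𝕜 := ℝ)).comp _ (Fin.castLE_injective h)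
  rw [← sq_eq_sq₀ (norm_nonneg _) (sliceNorm_nonneg_s2 h x), sq_sliceNorm,
    ← real_inner_self_eq_norm_sq, sliceProj, ho.inner_sum]
  simp [sq]

theorem contDiffAt_sliceNorm {x : EuclideanSpace ℝ (Fin n)} (hx : 0 < sliceNorm N h x) :
    ContDiffAt ℝ 1 (sliceNorm N h) x := by
  refine ContDiffAt.sqrt (by fun_prop) ?_
  rw [← sq_sliceNorm]
  positivity

theorem fderiv_sliceNorm_sliceProj {x : EuclideanSpace ℝ (Fin n)} (hx : 0 < sliceNorm N h x) :
    fderiv ℝ (sliceNorm N h) x (sliceProj h x) = sliceNorm N h x := by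
  have hd := ((contDiffAt_sliceNorm h hx).differentiableAt one_ne_zero).hasFDerivAt
  have h₁ := (hd.pow 2).congr_of_eventuallyEq
    (.of_forall fun y ↦ (sq_sliceNorm h y).symm)
  have h₂ : HasFDerivAt (fun y : EuclideanSpace ℝ (Fin n) ↦ ∑ i : Fin N, y (Fin.castLE h i) ^ 2)
      (∑ i : Fin N, (2 * x (Fin.castLE h i)) •
        (EuclideanSpace.proj (Fin.castLE h i) : EuclideanSpace ℝ (Fin n) →L[ℝ] ℝ)) x := by
    refine HasFDerivAt.fun_sum fun i _ ↦ ?_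
    simpa using ((EuclideanSpace.proj (Fin.castLE h i) :
      EuclideanSpace ℝ (Fin n) →L[ℝ] ℝ).hasFDerivAt (x := x)).pow 2
  have key := congrArg (· (sliceProj h x)) (h₁.unique h₂)
  simp only [smul_apply, sum_apply,
    EuclideanSpace.coe_proj, sliceProj_apply_castLE, smul_eq_mul, mul_assoc, ← sq,
    ← Finset.mul_sum, ← sq_sliceNorm, nsmul_eq_mul, Nat.cast_ofNat, Nat.add_one_sub_one, pow_one,
    mul_eq_mul_left_iff, OfNat.ofNat_ne_zero, or_false] at key
  rw [sq] at key
  exact mul_left_cancel₀ hx.ne' key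

/-- The divergence of `x ↦ (x', 0)` is `N`. -/
theorem integral_fderiv_sliceProj {g : EuclideanSpace ℝ (Fin n) → ℝ} (hg : ContDiff ℝ 1 g)
    (hgc : HasCompactSupport g) :
    ∫ x, fderiv ℝ g x (sliceProj h x) = -(N * ∫ x, g x) := by
  have hdc (v : EuclideanSpace ℝ (Fin n)) : Continuous fun x ↦ fderiv ℝ g x v :=
    (hg.continuous_fderiv one_ne_zero).clm_apply continuous_const
  have hds (v : EuclideanSpace ℝ (Fin n)) : HasCompactSupport fun x ↦ fderiv ℝ g x v :=
    hgc.fderiv_apply ℝ v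
  have hint (i : Fin N) : Integrable fun x : EuclideanSpace ℝ (Fin n) ↦
      x (Fin.castLE h i) * fderiv ℝ g x (EuclideanSpace.single (Fin.castLE h i) 1) :=
    Continuous.integrable_of_hasCompactSupport
      (Continuous.mul (by fun_prop) (hdc _)) (hds _).mul_left
  have hcoord (j : Fin n) (x : EuclideanSpace ℝ (Fin n)) :
      HasFDerivAt (fun y : EuclideanSpace ℝ (Fin n) ↦ y j)
        (EuclideanSpace.proj j : EuclideanSpace ℝ (Fin n) →L[ℝ] ℝ) x :=
    (EuclideanSpace.proj j : EuclideanSpace ℝ (Fin n) →L[ℝ] ℝ).hasFDerivAt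
  have hone (j : Fin n) : ∫ x : EuclideanSpace ℝ (Fin n),
      x j * fderiv ℝ g x (EuclideanSpace.single j 1) = -∫ x, g x := by
    have hcoord' (x : EuclideanSpace ℝ (Fin n)) :
        fderiv ℝ (fun y : EuclideanSpace ℝ (Fin n) ↦ y j) x (EuclideanSpace.single j 1) = 1 := by
      simp [(hcoord j x).fderiv]
    rw [integral_mul_fderiv_eq_neg_fderiv_mul_of_integrable]
    · simp [hcoord']
    · simpa [hcoord'] using hg.continuous.integrable_of_hasCompactSupport hgc
    · exact Continuous.integrable_of_hasCompactSupport
        (Continuous.mul (by fun_prop) (hdc _)) (hds _).mul_left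
    · exact Continuous.integrable_of_hasCompactSupport
        (Continuous.mul (by fun_prop) hg.continuous) hgc.mul_left
    · exact fun x _ ↦ (hcoord j x).differentiableAt
    · exact fun x _ ↦ (hg.differentiable one_ne_zero) x
  simp only [sliceProj, map_sum, map_smul, smul_eq_mul]
  rw [integral_finsetSum _ fun i _ ↦ hint i]
  simp [hone]

theorem continuous_mul_sliceNorm_rpow {φ : EuclideanSpace ℝ (Fin n) → ℝ} (hφ : Continuous φ)
    (hs : ∀ x ∈ tsupport φ, 0 < sliceNorm N h x) (β : ℝ) :
    Continuous fun x ↦ φ x * sliceNorm N h x ^ β :=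
  continuous_of_tsupport fun x hx ↦ by
    have hx' := hs x (tsupport_mul_subset_left hx)
    exact hφ.continuousAt.mul ((contDiffAt_sliceNorm h hx').continuousAt.rpow_const
      (.inl hx'.ne'))

/-- Integration by parts of a power of `|x'|` against the radial field in the `x'` variables. -/
theorem integral_sliceNorm_rpow_mul_fderiv {u : EuclideanSpace ℝ (Fin n) → ℝ}
    (hu : ContDiff ℝ 1 u) (huc : HasCompactSupport u)
    (hs : ∀ x ∈ tsupport u, 0 < sliceNorm N h x) (s : ℝ) :
    ∫ x, sliceNorm N h x ^ (-s) * fderiv ℝ u x (sliceProj h x) =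
      (s - N) * ∫ x, u x * sliceNorm N h x ^ (-s) := by
  set g := fun x ↦ u x * sliceNorm N h x ^ (-s) with hgdef
  have hw {x} (hx : 0 < sliceNorm N h x) :
      ContDiffAt ℝ 1 (fun y ↦ sliceNorm N h y ^ (-s)) x :=
    (contDiffAt_sliceNorm h hx).rpow_const_of_ne hx.ne'
  have hg : ContDiff ℝ 1 g := contDiff_iff_contDiffAt.2 fun x ↦ by
    by_cases hx : x ∈ tsupport g
    · exact hu.contDiffAt.mul (hw (hs x (tsupport_mul_subset_left hx)))
    · exact contDiffAt_const.congr_of_eventuallyEq (notMem_tsupport_iff_eventuallyEq.1 hx)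
  have hgc : HasCompactSupport g := huc.mul_right
  have hpt (x) : sliceNorm N h x ^ (-s) * fderiv ℝ u x (sliceProj h x) =
      fderiv ℝ g x (sliceProj h x) + s * g x := by
    by_cases hx : x ∈ tsupport u
    · have hr := hs x hx
      have hd := ((contDiffAt_sliceNorm h hr).differentiableAt one_ne_zero).hasFDerivAt
      have hgd := (hu.differentiable one_ne_zero x).hasFDerivAt.mul
        (hd.rpow_const (p := -s) (.inl hr.ne'))
      have hrs : sliceNorm N h x ^ (-s - 1) * sliceNorm N h x = sliceNorm N h x ^ (-s) := by
        rw [← Real.rpow_add_one hr.ne', sub_add_cancel]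
      rw [show fderiv ℝ g x = _ from hgd.fderiv]
      simp only [add_apply, smul_apply, smul_eq_mul,
        fderiv_sliceNorm_sliceProj h hr, hgdef, mul_assoc, hrs]
      ring
    · have hu0 : fderiv ℝ u x = 0 :=
        image_eq_zero_of_notMem_tsupport fun h' ↦ hx (tsupport_fderiv_subset ℝ h')
      have hgx : x ∉ tsupport g := fun h' ↦ hx (tsupport_mul_subset_left h')
      have hg0 : fderiv ℝ g x = 0 :=
        image_eq_zero_of_notMem_tsupport fun h' ↦ hgx (tsupport_fderiv_subset ℝ h')
      simp [hu0, hg0, image_eq_zero_of_notMem_tsupport hgx]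
  have hgi : Integrable g := hg.continuous.integrable_of_hasCompactSupport hgc
  have hgi' : Integrable fun x ↦ fderiv ℝ g x (sliceProj h x) := by
    refine Continuous.integrable_of_hasCompactSupport
      ((hg.continuous_fderiv one_ne_zero).clm_apply (by unfold sliceProj; fun_prop)) ?_
    exact (hgc.fderiv ℝ).mono fun x hx h0 ↦ hx (by simp [h0])
  simp_rw [hpt]
  rw [integral_add hgi' (hgi.const_mul s), integral_const_mul, integral_fderiv_sliceProj h hg hgc]
  ring

end SliceNorm

/-- Weighted horizontal `L^p`-Hardy inequality on `ℝⁿ = ℝ^N × ℝ^{n-N}`. -/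
theorem stmt2 (n N : ℕ) (hN : 1 ≤ N) (hNn : N ≤ n) (p α : ℝ) (hp1 : 1 < p)
    (f : EuclideanSpace ℝ (Fin n) → ℂ) (hf : ContDiff ℝ (⊤ : ℕ∞) f)
    (hfc : HasCompactSupport f)
    (hfs : tsupport f ⊆ {x | ∃ i : Fin N, x (Fin.castLE hNn i) ≠ 0}) :
    (|(N : ℝ) - p * (α + 1)| / p) *
        (∫ x, ‖f x‖ ^ p / sliceNorm N hNn x ^ ((α + 1) * p)) ^ (1 / p)
      ≤ (∫ x, ‖fderiv ℝ f x‖ ^ p / sliceNorm N hNn x ^ (α * p)) ^ (1 / p) := by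
  have hp0 : 0 < p := by linarith
  have hf1 : ContDiff ℝ 1 f := hf.of_le (by exact_mod_cast le_top)
  have hr0 := sliceNorm_nonneg_s2 (N := N) hNn
  have hpos (x) (hx : x ∈ tsupport f) : 0 < sliceNorm N hNn x := sliceNorm_pos hNn (hfs hx)
  simp_rw [Real.div_rpow_mul_eq_mul_rpow_neg_rpow (norm_nonneg _) (hr0 _)]
  set r := sliceNorm N hNn
  set F := fun x ↦ ‖f x‖ * r x ^ (-(α + 1)) with hF
  set G := fun x ↦ ‖fderiv ℝ f x‖ * r x ^ (-α) with hG
  have hF0 (x) : 0 ≤ F x := mul_nonneg (norm_nonneg _) (Real.rpow_nonneg (hr0 x) _)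
  have hG0 (x) : 0 ≤ G x := mul_nonneg (norm_nonneg _) (Real.rpow_nonneg (hr0 x) _)
  have hFcont : Continuous F := continuous_mul_sliceNorm_rpow hNn hf1.continuous.norm
    (fun x hx ↦ hpos x (tsupport_comp_subset norm_zero f hx)) _
  have hGcont : Continuous G :=
    continuous_mul_sliceNorm_rpow hNn (hf1.continuous_fderiv one_ne_zero).norm
      (fun x hx ↦ hpos x (tsupport_fderiv_subset ℝ
        (tsupport_comp_subset norm_zero (fderiv ℝ f) hx))) _
  have hFc : HasCompactSupport F := hfc.norm.mul_right
  have hGc : HasCompactSupport G := (hfc.fderiv ℝ).norm.mul_right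
  have hF1cont : Continuous fun x ↦ F x ^ (p - 1) :=
    hFcont.rpow_const fun _ ↦ .inr (by linarith)
  have hF1c : HasCompactSupport fun x ↦ F x ^ (p - 1) :=
    hFc.comp_left (g := fun t : ℝ ↦ t ^ (p - 1)) (Real.zero_rpow (by linarith))
  set u := fun x ↦ ‖f x‖ ^ p with hu
  have hu0 : (fun z : ℂ ↦ ‖z‖ ^ p) 0 = 0 := by simp [hp0.ne']
  have huF (x) : u x * r x ^ (-((α + 1) * p)) = F x ^ p := by
    rw [Real.rpow_neg (hr0 x), ← div_eq_mul_inv,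
      Real.div_rpow_mul_eq_mul_rpow_neg_rpow (norm_nonneg _) (hr0 x)]
  have hibp := integral_sliceNorm_rpow_mul_fderiv hNn (hf1.norm_rpow hp1)
    (hfc.comp_left (g := fun z : ℂ ↦ ‖z‖ ^ p) hu0)
    (fun x hx ↦ hpos x (tsupport_comp_subset (g := fun z : ℂ ↦ ‖z‖ ^ p) hu0 f hx)) ((α + 1) * p)
  change ∫ x, r x ^ (-((α + 1) * p)) * fderiv ℝ u x (sliceProj hNn x) =
    _ * ∫ x, u x * r x ^ (-((α + 1) * p)) at hibp
  simp_rw [huF] at hibp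
  have hbound (x) : ‖r x ^ (-((α + 1) * p)) * fderiv ℝ u x (sliceProj hNn x)‖ ≤
      p * (F x ^ (p - 1) * G x) := by
    have hdu : ‖fderiv ℝ u x‖ ≤ p * ‖f x‖ ^ (p - 1) * ‖fderiv ℝ f x‖ :=
      norm_fderiv_norm_rpow_le (hf1.differentiable one_ne_zero) hp1
    rw [norm_mul, Real.norm_of_nonneg (Real.rpow_nonneg (hr0 x) _)]
    by_cases hx : x ∈ tsupport f
    · have hr := hpos x hx
      calc r x ^ (-((α + 1) * p)) * ‖fderiv ℝ u x (sliceProj hNn x)‖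
          ≤ r x ^ (-((α + 1) * p)) * (p * ‖f x‖ ^ (p - 1) * ‖fderiv ℝ f x‖ * r x) := by
            gcongr
            refine ((fderiv ℝ u x).le_opNorm _).trans ?_
            rw [norm_sliceProj]
            gcongr
        _ = p * (F x ^ (p - 1) * G x) := by
            have hexp : r x ^ (-((α + 1) * p)) * r x =
                r x ^ (-(α + 1) * (p - 1)) * r x ^ (-α) := by
              rw [← Real.rpow_add_one hr.ne', ← Real.rpow_add hr]
              ring_nf
            rw [hF, hG]
            dsimp only
            rw [Real.mul_rpow (norm_nonneg _) (Real.rpow_nonneg hr.le _), ← Real.rpow_mul hr.le]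
            linear_combination (p * ‖f x‖ ^ (p - 1) * ‖fderiv ℝ f x‖) * hexp
    · have hdf : fderiv ℝ f x = 0 :=
        image_eq_zero_of_notMem_tsupport fun h' ↦ hx (tsupport_fderiv_subset ℝ h')
      have : fderiv ℝ u x = 0 := norm_le_zero_iff.1 (hdu.trans (by simp [hdf]))
      rw [this]
      simpa using mul_nonneg hp0.le (mul_nonneg (Real.rpow_nonneg (hF0 x) _) (hG0 x))
  have hA0 : 0 ≤ ∫ x, F x ^ p := integral_nonneg fun x ↦ Real.rpow_nonneg (hF0 x) _
  have hB0 : 0 ≤ ∫ x, G x ^ p := integral_nonneg fun x ↦ Real.rpow_nonneg (hG0 x) _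
  have hpq : (p / (p - 1)).HolderConjugate p := (Real.HolderConjugate.conjExponent hp1).symm
  have hholder := integral_mul_le_Lp_mul_Lq_of_nonneg (μ := volume) hpq
    (.of_forall fun x ↦ Real.rpow_nonneg (hF0 x) (p - 1)) (.of_forall hG0)
    (hF1cont.memLp_of_hasCompactSupport hF1c) (hGcont.memLp_of_hasCompactSupport hGc)
  have hFq (x) : (F x ^ (p - 1)) ^ (p / (p - 1)) = F x ^ p := by
    rw [← Real.rpow_mul (hF0 x), mul_div_cancel₀ _ (by linarith)]
  simp_rw [hFq] at hholder
  have hmain : |(N : ℝ) - p * (α + 1)| * ∫ x, F x ^ p ≤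
      p * ((∫ x, F x ^ p) ^ (1 / (p / (p - 1))) * (∫ x, G x ^ p) ^ (1 / p)) := by
    calc |(N : ℝ) - p * (α + 1)| * ∫ x, F x ^ p
        = ‖∫ x, r x ^ (-((α + 1) * p)) * fderiv ℝ u x (sliceProj hNn x)‖ := by
          rw [hibp, norm_mul, Real.norm_of_nonneg hA0, Real.norm_eq_abs, abs_sub_comm,
            mul_comm p]
      _ ≤ ∫ x, p * (F x ^ (p - 1) * G x) :=
          norm_integral_le_of_norm_le (((hF1cont.mul hGcont).integrable_of_hasCompactSupport
            hF1c.mul_right).const_mul p) (.of_forall hbound)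
      _ ≤ _ := by
          rw [integral_const_mul]
          gcongr
  rcases hA0.eq_or_lt with hA | hA
  · rw [← hA, Real.zero_rpow (by positivity), mul_zero]
    positivity
  · have hsplit : ∫ x, F x ^ p =
        (∫ x, F x ^ p) ^ (1 / (p / (p - 1))) * (∫ x, F x ^ p) ^ (1 / p) := by
      have hsum : 1 / (p / (p - 1)) + 1 / p = 1 := by
        simpa [one_div] using hpq.inv_add_inv_eq_one
      rw [← Real.rpow_add hA, hsum, Real.rpow_one]
    have hA' : 0 < (∫ x, F x ^ p) ^ (1 / (p / (p - 1))) := Real.rpow_pos_of_pos hA _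
    rw [div_mul_eq_mul_div, div_le_iff₀ hp0]
    refine le_of_mul_le_mul_left ?_ hA'
    calc _ = |(N : ℝ) - p * (α + 1)| * ∫ x, F x ^ p := by
          conv_rhs => rw [hsplit]
          ring
      _ ≤ _ := hmain
      _ = _ := by ring
end

section
/- (Classical Hardy inequality) Let n ≥ 2 and 1 < p < n. Then for every complex-valued f ∈ C_0^∞(ℝⁿ \ {0}) one has (∫_{ℝⁿ} |f(x)|^p / ‖x‖^p dx)^{1/p} ≤ (p/(n−p)) · (∫_{ℝⁿ} |∇f(x)|^p dx)^{1/p}, where ‖x‖ is the Euclidean norm on ℝⁿ. -/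
open MeasureTheory

/-- Integrating the divergence of `x ↦ g x • x` for a compactly supported `C¹` function `g`. -/
lemma integral_fderiv_apply_self_eq {n : ℕ} {g : EuclideanSpace ℝ (Fin n) → ℝ}
    (hg : ContDiff ℝ 1 g) (hgc : HasCompactSupport g) :
    ∫ x, fderiv ℝ g x x = -((n : ℝ) * ∫ x, g x) := by
  have hg' : Continuous (fderiv ℝ g) := hg.continuous_fderiv one_ne_zero
  have hd (i : Fin n) (x : EuclideanSpace ℝ (Fin n)) :
      HasFDerivAt (fun y : EuclideanSpace ℝ (Fin n) ↦ y i)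
        (EuclideanSpace.proj i : EuclideanSpace ℝ (Fin n) →L[ℝ] ℝ) x :=
    (EuclideanSpace.proj i : EuclideanSpace ℝ (Fin n) →L[ℝ] ℝ).hasFDerivAt
  have hint (i : Fin n) :
      Integrable (fun x ↦ x i * fderiv ℝ g x (EuclideanSpace.single i 1)) := by
    refine Continuous.integrable_of_hasCompactSupport (by fun_prop) ?_
    exact (hgc.fderiv_apply (𝕜 := ℝ) (EuclideanSpace.single i 1)).mul_left
  have hpart (i : Fin n) :
      ∫ x, x i * fderiv ℝ g x (EuclideanSpace.single i 1) = -∫ x, g x := by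
    have hfd (x : EuclideanSpace ℝ (Fin n)) :
        fderiv ℝ (fun y : EuclideanSpace ℝ (Fin n) ↦ y i) x (EuclideanSpace.single i 1) = 1 := by
      rw [(hd i x).fderiv]
      simp
    have h := integral_mul_fderiv_eq_neg_fderiv_mul_of_integrable (μ := volume)
      (f := fun y : EuclideanSpace ℝ (Fin n) ↦ y i) (g := g) (v := EuclideanSpace.single i 1)
      (by simpa only [hfd, one_mul] using hg.continuous.integrable_of_hasCompactSupport hgc)
      (hint i)
      (Continuous.integrable_of_hasCompactSupport
        ((by fun_prop : Continuous fun y : EuclideanSpace ℝ (Fin n) ↦ y i).mul hg.continuous)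
        hgc.mul_left)
      (fun x _ ↦ (hd i x).differentiableAt)
      (fun x _ ↦ hg.differentiable one_ne_zero x)
    simpa only [hfd, one_mul] using h
  have hsum (x : EuclideanSpace ℝ (Fin n)) :
      fderiv ℝ g x x = ∑ i, x i * fderiv ℝ g x (EuclideanSpace.single i 1) := by
    have h := congrArg (fderiv ℝ g x) ((EuclideanSpace.basisFun (Fin n) ℝ).sum_repr x)
    rw [← h, map_sum]
    simp
  simp_rw [hsum]
  rw [integral_finsetSum _ fun i _ ↦ hint i]
  simp [hpart]

/-- Dividing by the norm preserves smoothness for functions supported away from the origin. -/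
lemma contDiff_norm_inv_smul {E F : Type*} [NormedAddCommGroup E] [InnerProductSpace ℝ E]
    [NormedAddCommGroup F] [NormedSpace ℝ F] {f : E → F} {k : WithTop ℕ∞}
    (hf : ContDiff ℝ k f) (hfs : tsupport f ⊆ {(0 : E)}ᶜ) :
    ContDiff ℝ k fun x ↦ ‖x‖⁻¹ • f x := by
  rw [contDiff_iff_contDiffAt]
  intro x
  by_cases hx : x = 0
  · have hx' : x ∉ tsupport f := fun h ↦ hfs h hx
    refine (contDiffAt_const (c := (0 : F))).congr_of_eventuallyEq ?_
    filter_upwards [notMem_tsupport_iff_eventuallyEq.mp hx'] with y hy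
    simp [hy]
  · exact ((contDiffAt_norm ℝ hx).inv (norm_ne_zero_iff.mpr hx)).smul hf.contDiffAt

/-- The radial derivative of `‖x‖⁻¹ • f x`. -/
lemma fderiv_norm_inv_smul_apply_self {E F : Type*} [NormedAddCommGroup E] [InnerProductSpace ℝ E]
    [NormedAddCommGroup F] [NormedSpace ℝ F] {f : E → F} {x : E}
    (hf : DifferentiableAt ℝ f x) (hx : x ≠ 0) :
    fderiv ℝ (fun y ↦ ‖y‖⁻¹ • f y) x x = ‖x‖⁻¹ • fderiv ℝ f x x - ‖x‖⁻¹ • f x := by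
  have hx' : ‖x‖ ≠ 0 := norm_ne_zero_iff.mpr hx
  have hn : DifferentiableAt ℝ (fun y : E ↦ ‖y‖) x :=
    (contDiffAt_norm (n := 1) ℝ hx).differentiableAt one_ne_zero
  have hinv : HasFDerivAt (fun y : E ↦ ‖y‖⁻¹) (-(‖x‖ ^ 2)⁻¹ • fderiv ℝ (fun y : E ↦ ‖y‖) x) x :=
    (hasDerivAt_inv hx').comp_hasFDerivAt x hn.hasFDerivAt
  have h : HasFDerivAt (fun y ↦ ‖y‖⁻¹ • f y) _ x := hinv.smul hf.hasFDerivAt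
  rw [h.fderiv]
  simp only [add_apply, smul_apply,
    ContinuousLinearMap.smulRight_apply, hn.fderiv_norm_self, smul_eq_mul, sub_eq_add_neg,
    ← neg_smul]
  congr 2
  field_simp

/-- A lower bound for the radial derivative of `‖f x‖ ^ p / ‖x‖ ^ p`. -/
lemma neg_le_fderiv_norm_rpow_norm_inv_smul {E F : Type*} [NormedAddCommGroup E]
    [InnerProductSpace ℝ E] [NormedAddCommGroup F] [InnerProductSpace ℝ F] {f : E → F}
    (hf : ContDiff ℝ 1 f) (hfs : tsupport f ⊆ {(0 : E)}ᶜ) {p : ℝ} (hp : 1 < p) (x : E) :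
    -(p * (‖fderiv ℝ f x‖ * ‖‖x‖⁻¹ • f x‖ ^ (p - 1))) - p * ‖‖x‖⁻¹ • f x‖ ^ p
      ≤ fderiv ℝ (fun y ↦ ‖‖y‖⁻¹ • f y‖ ^ p) x x := by
  have hp0 : 0 < p := by linarith
  by_cases hx : x = 0
  · simp [hx, Real.zero_rpow hp0.ne', Real.zero_rpow (sub_pos.mpr hp).ne']
  have hu := (contDiff_norm_inv_smul hf hfs).differentiable one_ne_zero
  rw [hu.fderiv_norm_rpow hp]
  simp only [smul_apply, ContinuousLinearMap.comp_apply, innerSL_apply_apply,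
    smul_eq_mul, fderiv_norm_inv_smul_apply_self (hf.differentiable one_ne_zero x) hx,
    inner_sub_right, real_inner_self_eq_norm_sq]
  set u := ‖x‖⁻¹ • f x with hudef
  by_cases hu0 : u = 0
  · simp [hu0, Real.zero_rpow hp0.ne', Real.zero_rpow (sub_pos.mpr hp).ne']
  have hupos : 0 < ‖u‖ := norm_pos_iff.mpr hu0
  have hx' : 0 < ‖x‖ := norm_pos_iff.mpr hx
  have h2 : ‖u‖ ^ (p - 2) * ‖u‖ ^ 2 = ‖u‖ ^ p := by
    rw [← Real.rpow_natCast, ← Real.rpow_add hupos]; norm_num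
  have h1 : ‖u‖ ^ (p - 2) * ‖u‖ = ‖u‖ ^ (p - 1) := by
    rw [← Real.rpow_add_one hupos.ne']; ring_nf
  have hv : ‖‖x‖⁻¹ • fderiv ℝ f x x‖ ≤ ‖fderiv ℝ f x‖ := by
    rw [norm_smul, norm_inv, norm_norm, inv_mul_le_iff₀ hx', mul_comm]
    exact (fderiv ℝ f x).le_opNorm x
  have hin : -(‖u‖ * ‖fderiv ℝ f x‖) ≤ inner ℝ u (‖x‖⁻¹ • fderiv ℝ f x x) :=
    (neg_le_neg (by gcongr)).trans (neg_le_of_abs_le (abs_real_inner_le_norm u _))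
  have hk : 0 ≤ p * ‖u‖ ^ (p - 2) := by positivity
  calc _ = p * ‖u‖ ^ (p - 2) * (-(‖u‖ * ‖fderiv ℝ f x‖) - ‖u‖ ^ 2) := by
        rw [← h2, ← h1]; ring
    _ ≤ _ := mul_le_mul_of_nonneg_left (by linarith) hk

/-- A pointwise lower bound for the radial derivative of `‖u x‖ ^ p` integrates to a Hardy
inequality for `u`. -/
lemma integral_norm_rpow_le_of_neg_le_fderiv {n : ℕ} {p : ℝ} (hp1 : 1 < p) (hpn : p < n)
    {f u : EuclideanSpace ℝ (Fin n) → ℂ} (hf1 : ContDiff ℝ 1 f) (hfc : HasCompactSupport f)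
    (hu : ContDiff ℝ 1 u) (huc : HasCompactSupport u)
    (hbound : ∀ x, -(p * (‖fderiv ℝ f x‖ * ‖u x‖ ^ (p - 1))) - p * ‖u x‖ ^ p
      ≤ fderiv ℝ (fun y ↦ ‖u y‖ ^ p) x x) :
    (∫ x, ‖u x‖ ^ p) ^ (1 / p)
      ≤ (p / ((n : ℝ) - p)) * (∫ x, ‖fderiv ℝ f x‖ ^ p) ^ (1 / p) := by
  have hp0 : 0 < p := by linarith
  have hg : ContDiff ℝ 1 fun x ↦ ‖u x‖ ^ p := hu.norm_rpow hp1
  have hgc : HasCompactSupport fun x ↦ ‖u x‖ ^ p :=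
    huc.comp_left (g := fun z : ℂ ↦ ‖z‖ ^ p) (by simp [Real.zero_rpow hp0.ne'])
  have hwcont : Continuous fun x ↦ ‖u x‖ ^ (p - 1) :=
    hu.continuous.norm.rpow_const fun _ ↦ Or.inr (by linarith)
  have hwc : HasCompactSupport fun x ↦ ‖u x‖ ^ (p - 1) :=
    huc.comp_left (g := fun z : ℂ ↦ ‖z‖ ^ (p - 1))
      (by simp [Real.zero_rpow (sub_pos.mpr hp1).ne'])
  have hDcont : Continuous fun x ↦ ‖fderiv ℝ f x‖ := (hf1.continuous_fderiv one_ne_zero).norm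
  have hDc : HasCompactSupport fun x ↦ ‖fderiv ℝ f x‖ := (hfc.fderiv (𝕜 := ℝ)).norm
  have hgint : Integrable fun x ↦ ‖u x‖ ^ p := hg.continuous.integrable_of_hasCompactSupport hgc
  have hDwint : Integrable fun x ↦ ‖fderiv ℝ f x‖ * ‖u x‖ ^ (p - 1) :=
    (hDcont.mul hwcont).integrable_of_hasCompactSupport hDc.mul_right
  have hdint : Integrable fun x ↦ fderiv ℝ (fun y ↦ ‖u y‖ ^ p) x x := by
    refine ((hg.continuous_fderiv one_ne_zero).clm_apply
      continuous_id).integrable_of_hasCompactSupport ?_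
    exact (hgc.fderiv (𝕜 := ℝ)).mono fun x hx h ↦ hx (by simp [h])
  have hint := integral_mono ((hDwint.const_mul p).neg.sub (hgint.const_mul p)) hdint hbound
  rw [integral_fderiv_apply_self_eq hg hgc,
    integral_sub' (hDwint.const_mul p).neg (hgint.const_mul p), integral_neg',
    integral_const_mul, integral_const_mul] at hint
  have hpq : p.HolderConjugate (p / (p - 1)) := Real.HolderConjugate.conjExponent hp1
  have hold := integral_mul_le_Lp_mul_Lq_of_nonneg hpq (μ := volume)
    (.of_forall fun x ↦ norm_nonneg (fderiv ℝ f x))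
    (.of_forall fun x ↦ Real.rpow_nonneg (norm_nonneg (u x)) (p - 1))
    (hDcont.memLp_of_hasCompactSupport hDc) (hwcont.memLp_of_hasCompactSupport hwc)
  have hwq (x) : (‖u x‖ ^ (p - 1)) ^ (p / (p - 1)) = ‖u x‖ ^ p := by
    rw [← Real.rpow_mul (norm_nonneg _), mul_div_cancel₀ _ (sub_pos.mpr hp1).ne']
  simp_rw [hwq] at hold
  set A := ∫ x, ‖u x‖ ^ p
  set B := ∫ x, ‖fderiv ℝ f x‖ ^ p
  have hnp : 0 < (n : ℝ) - p := by linarith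
  have hB : 0 ≤ B := by positivity
  rcases (show 0 ≤ A by positivity).eq_or_lt with hA | hA
  · rw [← hA, Real.zero_rpow (by positivity)]
    positivity
  have hsplit : A = A ^ (1 / p) * A ^ (1 / (p / (p - 1))) := by
    rw [← Real.rpow_add hA, one_div, one_div, hpq.inv_add_inv_eq_one, Real.rpow_one]
  have hAq : 0 < A ^ (1 / (p / (p - 1))) := by positivity
  rw [div_mul_eq_mul_div, le_div_iff₀ hnp]
  refine le_of_mul_le_mul_right ?_ hAq
  calc A ^ (1 / p) * (n - p) * A ^ (1 / (p / (p - 1))) = (n - p) * A := by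
        conv_rhs => rw [hsplit]
        ring
    _ ≤ p * ∫ x, ‖fderiv ℝ f x‖ * ‖u x‖ ^ (p - 1) := by linarith
    _ ≤ p * (B ^ (1 / p) * A ^ (1 / (p / (p - 1)))) := by gcongr
    _ = _ := by ring

/-- Classical Hardy inequality on `ℝⁿ`, `1 < p < n`. -/
theorem stmt5 (n : ℕ) (hn : 2 ≤ n) (p : ℝ) (hp1 : 1 < p) (hpn : p < n)
    (f : EuclideanSpace ℝ (Fin n) → ℂ) (hf : ContDiff ℝ (⊤ : ℕ∞) f)
    (hfc : HasCompactSupport f) (hfs : tsupport f ⊆ {(0 : EuclideanSpace ℝ (Fin n))}ᶜ) :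
    (∫ x, ‖f x‖ ^ p / ‖x‖ ^ p) ^ (1 / p)
      ≤ (p / ((n : ℝ) - p)) * (∫ x, ‖fderiv ℝ f x‖ ^ p) ^ (1 / p) := by
  have hf1 : ContDiff ℝ 1 f := contDiff_infty.mp hf 1
  have hueq (x : EuclideanSpace ℝ (Fin n)) : ‖f x‖ ^ p / ‖x‖ ^ p = ‖‖x‖⁻¹ • f x‖ ^ p := by
    rw [norm_smul, norm_inv, norm_norm, inv_mul_eq_div,
      Real.div_rpow (norm_nonneg _) (norm_nonneg _)]
  simp_rw [hueq]
  exact integral_norm_rpow_le_of_neg_le_fderiv hp1 hpn hf1 hfc (contDiff_norm_inv_smul hf1 hfs)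
    (hfc.mono fun x hx h ↦ hx (by simp [h])) (neg_le_fderiv_norm_rpow_norm_inv_smul hf1 hfs hp1)
end

section
/- (Heisenberg–Pauli–Weyl uncertainty principle) Let n ≥ 3. Then for every complex-valued f ∈ C_0^∞(ℝⁿ \ {0}) one has (∫_{ℝⁿ} |f(x)|² dx)² ≤ (2/(n−2))² · (∫_{ℝⁿ} |∇f(x)|² dx) · (∫_{ℝⁿ} ‖x‖² |f(x)|² dx), where ‖x‖ is the Euclidean norm on ℝⁿ. -/
open MeasureTheory

/-- Integrating the radial derivative `x · ∇g` by parts produces the factor `-n`. -/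
lemma integral_fderiv_apply_self {n : ℕ} {g : EuclideanSpace ℝ (Fin n) → ℝ}
    (hg : ContDiff ℝ 1 g) (hgc : HasCompactSupport g) :
    ∫ x, fderiv ℝ g x x = -(n * ∫ x, g x) := by
  have hg' : Continuous (fderiv ℝ g) := hg.continuous_fderiv one_ne_zero
  have hint (i : Fin n) : Integrable
      (fun x : EuclideanSpace ℝ (Fin n) ↦ x i * fderiv ℝ g x (EuclideanSpace.single i 1)) :=
    Continuous.integrable_of_hasCompactSupport (by fun_prop)
      ((hgc.fderiv_apply (𝕜 := ℝ) _).mul_left)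
  have hproj (i : Fin n) (x : EuclideanSpace ℝ (Fin n)) :
      fderiv ℝ (fun y : EuclideanSpace ℝ (Fin n) ↦ y i) x (EuclideanSpace.single i 1) = 1 := by
    have : HasFDerivAt (fun y : EuclideanSpace ℝ (Fin n) ↦ y i)
        (EuclideanSpace.proj (𝕜 := ℝ) i) x := (EuclideanSpace.proj (𝕜 := ℝ) i).hasFDerivAt
    simp [this.fderiv]
  have hparts (i : Fin n) :
      ∫ x : EuclideanSpace ℝ (Fin n), x i * fderiv ℝ g x (EuclideanSpace.single i 1)
        = -∫ x, g x := by
    rw [integral_mul_fderiv_eq_neg_fderiv_mul_of_integrable _ (hint i)]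
    · simp only [hproj, one_mul]
    · exact Continuous.integrable_of_hasCompactSupport
        ((by fun_prop : Continuous fun x : EuclideanSpace ℝ (Fin n) ↦ x i).mul hg.continuous)
        hgc.mul_left
    · intro x _
      fun_prop
    · intro x _
      exact hg.differentiable one_ne_zero x
    · simp only [hproj, one_mul]
      exact hg.continuous.integrable_of_hasCompactSupport hgc
  have hsum (x : EuclideanSpace ℝ (Fin n)) :
      fderiv ℝ g x x = ∑ i, x i * fderiv ℝ g x (EuclideanSpace.single i 1) := by
    conv_lhs => arg 2; rw [← (EuclideanSpace.basisFun (Fin n) ℝ).sum_repr x]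
    simp
  simp_rw [hsum]
  rw [integral_finsetSum _ fun i _ ↦ hint i]
  simp [hparts]

/-- The Cauchy–Schwarz inequality for continuous compactly supported real functions. -/
lemma sq_integral_mul_le_of_hasCompactSupport {E : Type*} [TopologicalSpace E]
    [MeasurableSpace E] [OpensMeasurableSpace E] {μ : Measure E} [IsFiniteMeasureOnCompacts μ]
    {u v : E → ℝ} (hu : Continuous u) (hv : Continuous v)
    (huc : HasCompactSupport u) (hvc : HasCompactSupport v) :
    (∫ x, u x * v x ∂μ) ^ 2 ≤ (∫ x, u x ^ 2 ∂μ) * ∫ x, v x ^ 2 ∂μ := by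
  have huu : Integrable (fun x ↦ u x ^ 2) μ := by
    simp only [sq]
    exact (hu.mul hu).integrable_of_hasCompactSupport huc.mul_right
  have hvv : Integrable (fun x ↦ v x ^ 2) μ := by
    simp only [sq]
    exact (hv.mul hv).integrable_of_hasCompactSupport hvc.mul_right
  have huv : Integrable (fun x ↦ u x * v x) μ :=
    (hu.mul hv).integrable_of_hasCompactSupport huc.mul_right
  have hdiscrim := discrim_le_zero (a := ∫ x, u x ^ 2 ∂μ) (b := 2 * ∫ x, u x * v x ∂μ)
    (c := ∫ x, v x ^ 2 ∂μ) fun t ↦ by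
      calc (0 : ℝ) ≤ ∫ x, (t * u x + v x) ^ 2 ∂μ := integral_nonneg fun x ↦ sq_nonneg _
        _ = ∫ x, t * t * u x ^ 2 + 2 * t * (u x * v x) + v x ^ 2 ∂μ := by
          congr with x; ring
        _ = _ := by
          have huuv : Integrable (fun x ↦ t * t * u x ^ 2 + 2 * t * (u x * v x)) μ :=
            (huu.const_mul _).add (huv.const_mul _)
          rw [integral_add huuv hvv, integral_add (huu.const_mul _) (huv.const_mul _),
            integral_const_mul, integral_const_mul]
          ring
  rw [discrim] at hdiscrim
  linarith

/-- Heisenberg–Pauli–Weyl uncertainty principle on `ℝⁿ`, `n ≥ 3`. -/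
theorem stmt6 (n : ℕ) (hn : 3 ≤ n)
    (f : EuclideanSpace ℝ (Fin n) → ℂ) (hf : ContDiff ℝ (⊤ : ℕ∞) f)
    (hfc : HasCompactSupport f) (hfs : tsupport f ⊆ {(0 : EuclideanSpace ℝ (Fin n))}ᶜ) :
    (∫ x, ‖f x‖ ^ 2) ^ 2
      ≤ (2 / ((n : ℝ) - 2)) ^ 2 * (∫ x, ‖fderiv ℝ f x‖ ^ 2) * ∫ x, ‖x‖ ^ 2 * ‖f x‖ ^ 2 := by
  have hf1 : ContDiff ℝ 1 f := hf.of_le (by exact_mod_cast le_top)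
  have hf' : Continuous (fderiv ℝ f) := hf1.continuous_fderiv one_ne_zero
  have hu : Continuous fun x ↦ ‖fderiv ℝ f x‖ := hf'.norm
  have hv : Continuous fun x ↦ ‖x‖ * ‖f x‖ := continuous_norm.mul hf.continuous.norm
  have huc : HasCompactSupport fun x ↦ ‖fderiv ℝ f x‖ := (hfc.fderiv (𝕜 := ℝ)).norm
  have hvc : HasCompactSupport fun x ↦ ‖x‖ * ‖f x‖ := hfc.norm.mul_left
  have hderiv (x : EuclideanSpace ℝ (Fin n)) :
      fderiv ℝ (fun y ↦ ‖f y‖ ^ 2) x x = 2 * inner ℝ (f x) (fderiv ℝ f x x) := by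
    rw [((hf1.differentiable one_ne_zero x).hasFDerivAt.norm_sq).fderiv]
    simp [mul_add]
  have hmass : n * ∫ x, ‖f x‖ ^ 2 ≤ 2 * ∫ x, ‖fderiv ℝ f x‖ * (‖x‖ * ‖f x‖) := by
    have hparts := integral_fderiv_apply_self (hf1.norm_sq ℝ)
      (hfc.norm.comp_left (g := (· ^ 2)) (by simp))
    calc n * ∫ x, ‖f x‖ ^ 2 = -∫ x, fderiv ℝ (fun y ↦ ‖f y‖ ^ 2) x x := by
          rw [eq_neg_iff_add_eq_zero, ← eq_neg_iff_add_eq_zero.mp hparts, add_comm]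
      _ ≤ ‖∫ x, fderiv ℝ (fun y ↦ ‖f y‖ ^ 2) x x‖ := neg_le_abs _
      _ ≤ ∫ x, 2 * (‖fderiv ℝ f x‖ * (‖x‖ * ‖f x‖)) := by
          refine norm_integral_le_of_norm_le (((hu.mul hv).integrable_of_hasCompactSupport
            huc.mul_right).const_mul 2) (.of_forall fun x ↦ ?_)
          rw [hderiv, norm_mul, Real.norm_two]
          gcongr
          calc ‖inner ℝ (f x) (fderiv ℝ f x x)‖ ≤ ‖f x‖ * ‖fderiv ℝ f x x‖ := norm_inner_le_norm _ _
            _ ≤ ‖f x‖ * (‖fderiv ℝ f x‖ * ‖x‖) := by gcongr; exact (fderiv ℝ f x).le_opNorm x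
            _ = ‖fderiv ℝ f x‖ * (‖x‖ * ‖f x‖) := by ring
      _ = _ := integral_const_mul _ _
  have hcs := sq_integral_mul_le_of_hasCompactSupport (μ := volume) hu hv huc hvc
  simp_rw [mul_pow] at hcs
  have hn' : (0 : ℝ) < n - 2 := by
    have : (3 : ℝ) ≤ n := by exact_mod_cast hn
    linarith
  have hI : 0 ≤ ∫ x, ‖f x‖ ^ 2 := integral_nonneg fun x ↦ by positivity
  have hle : ∫ x, ‖f x‖ ^ 2 ≤ 2 / ((n : ℝ) - 2) * ∫ x, ‖fderiv ℝ f x‖ * (‖x‖ * ‖f x‖) := by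
    rw [div_mul_eq_mul_div, le_div_iff₀ hn']
    linarith
  calc (∫ x, ‖f x‖ ^ 2) ^ 2
      ≤ (2 / ((n : ℝ) - 2) * ∫ x, ‖fderiv ℝ f x‖ * (‖x‖ * ‖f x‖)) ^ 2 := by gcongr
    _ ≤ (2 / ((n : ℝ) - 2)) ^ 2 *
        ((∫ x, ‖fderiv ℝ f x‖ ^ 2) * ∫ x, ‖x‖ ^ 2 * ‖f x‖ ^ 2) := by
      rw [mul_pow]
      gcongr
    _ = _ := by ring
end

section
/- Let 2 ≤ N ≤ n be integers and 1 < p < N. Then for every complex-valued f ∈ C_0^∞(ℝⁿ \ {x' = 0}) one has ∫_{ℝⁿ} |f(x)|² dx ≤ (p/(N−p)) · (∫_{ℝⁿ} |∇f(x)|^p dx)^{1/p} · (∫_{ℝⁿ} (|x'| |f(x)|)^{p/(p−1)} dx)^{(p−1)/p}. -/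
open MeasureTheory

/-- The orthogonal projection of `ℝⁿ` onto the span of the first `N` coordinate vectors. -/
noncomputable def headProj (n N : ℕ) :
    EuclideanSpace ℝ (Fin n) →L[ℝ] EuclideanSpace ℝ (Fin n) :=
  LinearMap.toContinuousLinearMap
    { toFun := fun x => WithLp.toLp 2 fun j => if (j : ℕ) < N then x j else 0
      map_add' := fun x y => by ext j; by_cases h : (j : ℕ) < N <;> simp [h]
      map_smul' := fun c x => by ext j; by_cases h : (j : ℕ) < N <;> simp [h] }

theorem headProj_apply {n N : ℕ} (x : EuclideanSpace ℝ (Fin n)) (j : Fin n) :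
    headProj n N x j = if (j : ℕ) < N then x j else 0 := rfl

theorem headProj_headProj {n N : ℕ} (x : EuclideanSpace ℝ (Fin n)) :
    headProj n N (headProj n N x) = headProj n N x := by
  ext j
  by_cases h : (j : ℕ) < N <;> simp [headProj_apply, h]

theorem Fin.sum_ite_val_lt {n N : ℕ} (h : N ≤ n) (g : Fin n → ℝ) :
    ∑ j : Fin n, (if (j : ℕ) < N then g j else 0) = ∑ i : Fin N, g (Fin.castLE h i) := by
  obtain ⟨m, rfl⟩ := Nat.exists_eq_add_of_le h
  rw [Fin.sum_univ_add]
  simp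
  rfl

theorem norm_headProj {n N : ℕ} (h : N ≤ n) (x : EuclideanSpace ℝ (Fin n)) :
    ‖headProj n N x‖ = sliceNorm N h x := by
  rw [EuclideanSpace.norm_eq, sliceNorm, ← Fin.sum_ite_val_lt h fun j => x j ^ 2]
  congr 1
  refine Finset.sum_congr rfl fun j _ => ?_
  by_cases hj : (j : ℕ) < N <;> simp [headProj_apply, hj]

theorem trace_headProj {n N : ℕ} (h : N ≤ n) :
    ∑ j, headProj n N (EuclideanSpace.single j 1) j = N := by
  simp only [headProj_apply, PiLp.single_apply, if_true]
  rw [Fin.sum_ite_val_lt h]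
  simp

theorem HasCompactSupport.of_eq_zero_imp {X Y Z : Type*} [TopologicalSpace X] [Zero Y] [Zero Z]
    {f : X → Y} {g : X → Z} (hf : HasCompactSupport f) (h : ∀ x, f x = 0 → g x = 0) :
    HasCompactSupport g :=
  hf.mono fun x hx h0 => hx (h x h0)

/-- Integration by parts against a linear vector field. -/
theorem integral_fderiv_apply_linear {n : ℕ}
    (Q : EuclideanSpace ℝ (Fin n) →L[ℝ] EuclideanSpace ℝ (Fin n))
    {G : EuclideanSpace ℝ (Fin n) → ℝ} (hG : ContDiff ℝ 1 G) (hGc : HasCompactSupport G) :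
    ∫ x, fderiv ℝ G x (Q x) = -((∑ j, Q (EuclideanSpace.single j 1) j) * ∫ x, G x) := by
  have hG' : Continuous (fderiv ℝ G) := hG.continuous_fderiv one_ne_zero
  have hcoord : ∀ j, ∃ L : EuclideanSpace ℝ (Fin n) →L[ℝ] ℝ, ∀ x, L x = Q x j := fun j =>
    ⟨(EuclideanSpace.proj j).comp Q, fun x => rfl⟩
  choose L hL using hcoord
  have hint : ∀ j, Integrable fun x => L j x * fderiv ℝ G x (EuclideanSpace.single j 1) := by
    intro j
    refine Continuous.integrable_of_hasCompactSupport (by fun_prop) ?_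
    exact (hGc.fderiv ℝ).mono fun x hx h0 => hx (by simp [h0])
  have hintG : Integrable G := hG.continuous.integrable_of_hasCompactSupport hGc
  have hexp : ∀ x, fderiv ℝ G x (Q x) =
      ∑ j, L j x * fderiv ℝ G x (EuclideanSpace.single j 1) := by
    intro x
    have hQ : Q x = ∑ j, L j x • EuclideanSpace.single j (1 : ℝ) := by
      ext k
      simp [hL, Pi.single_apply]
    conv_lhs => rw [hQ]
    simp
  simp_rw [hexp]
  rw [integral_finsetSum _ fun j _ => hint j, Finset.sum_mul, ← Finset.sum_neg_distrib]
  refine Finset.sum_congr rfl fun j _ => ?_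
  rw [integral_mul_fderiv_eq_neg_fderiv_mul_of_integrable _ (hint j) _
    (fun x _ => (L j).differentiableAt) fun x _ => hG.differentiable one_ne_zero x]
  · simp [integral_const_mul, hL]
  · simpa using hintG.const_mul _
  · refine Continuous.integrable_of_hasCompactSupport
      ((L j).continuous.mul hG.continuous) hGc.mul_left

theorem contDiff_inv_norm_smul {E F : Type*} [NormedAddCommGroup E] [NormedSpace ℝ E]
    [NormedAddCommGroup F] [InnerProductSpace ℝ F] {Q : E →L[ℝ] F} {f : E → ℂ}
    (hf : ContDiff ℝ 1 f) (hQ : ∀ x ∈ tsupport f, Q x ≠ 0) :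
    ContDiff ℝ 1 fun x => ‖Q x‖⁻¹ • f x := by
  rw [contDiff_iff_contDiffAt]
  intro x
  by_cases hx : x ∈ tsupport f
  · exact ((Q.contDiff.contDiffAt.norm ℝ (hQ x hx)).inv (norm_ne_zero_iff.2 (hQ x hx))).smul
      hf.contDiffAt
  · have h0 := notMem_tsupport_iff_eventuallyEq.1 hx
    refine (contDiffAt_const (c := (0 : ℂ))).congr_of_eventuallyEq ?_
    filter_upwards [h0] with y hy
    simp [hy]

/-- The quotient `f / |Q x|` differentiated along the Euler field of the projection `Q`. -/
theorem fderiv_inv_norm_smul_apply {E : Type*} [NormedAddCommGroup E] [InnerProductSpace ℝ E]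
    {Q : E →L[ℝ] E} (hQQ : ∀ x, Q (Q x) = Q x) {f : E → ℂ}
    (hf : ContDiff ℝ 1 f) (hQ : ∀ x ∈ tsupport f, Q x ≠ 0) (x : E) :
    fderiv ℝ (fun x => ‖Q x‖⁻¹ • f x) x (Q x) =
      ‖Q x‖⁻¹ • fderiv ℝ f x (Q x) - ‖Q x‖⁻¹ • f x := by
  by_cases hx : x ∈ tsupport f
  · have hx0 : ‖Q x‖ ≠ 0 := norm_ne_zero_iff.2 (hQ x hx)
    have hn : DifferentiableAt ℝ (‖·‖) (Q x) :=
      (contDiffAt_norm ℝ (hQ x hx) : ContDiffAt ℝ 1 _ _).differentiableAt one_ne_zero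
    have hr : HasFDerivAt (fun x => ‖Q x‖) ((fderiv ℝ (‖·‖) (Q x)).comp Q) x :=
      hn.hasFDerivAt.comp x Q.hasFDerivAt
    have hinv : HasFDerivAt (fun x => ‖Q x‖⁻¹)
        ((-(‖Q x‖ ^ 2)⁻¹) • (fderiv ℝ (‖·‖) (Q x)).comp Q) x :=
      (hasDerivAt_inv hx0).comp_hasFDerivAt x hr
    have h := (hinv.smul (hf.differentiable one_ne_zero x).hasFDerivAt).fderiv
    have hself : fderiv ℝ (‖·‖) (Q x) (Q x) = ‖Q x‖ := hn.fderiv_norm_self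
    have h2 := DFunLike.congr_fun h (Q x)
    refine h2.trans ?_
    have h3 : (‖Q x‖ ^ 2)⁻¹ * ‖Q x‖ = ‖Q x‖⁻¹ := by field_simp
    simp [hQQ, hself, h3, sub_eq_add_neg]
  · have h0 := notMem_tsupport_iff_eventuallyEq.1 hx
    have h1 : (fun x => ‖Q x‖⁻¹ • f x) =ᶠ[nhds x] fun _ => 0 := by
      filter_upwards [h0] with y hy
      simp [hy]
    have h2 : f =ᶠ[nhds x] fun _ => (0 : ℂ) := h0
    rw [h1.fderiv_eq, h2.fderiv_eq, h2.self_of_nhds]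
    simp

theorem neg_fderiv_norm_rpow_inv_norm_smul_apply_le {E : Type*} [NormedAddCommGroup E]
    [InnerProductSpace ℝ E] {Q : E →L[ℝ] E} (hQQ : ∀ x, Q (Q x) = Q x) {p : ℝ} (hp : 1 < p)
    {f : E → ℂ} (hf : ContDiff ℝ 1 f) (hQ : ∀ x ∈ tsupport f, Q x ≠ 0) (x : E) :
    -fderiv ℝ (fun x => ‖‖Q x‖⁻¹ • f x‖ ^ p) x (Q x) ≤
      p * (‖‖Q x‖⁻¹ • f x‖ ^ (p - 1) * ‖fderiv ℝ f x‖) + p * ‖‖Q x‖⁻¹ • f x‖ ^ p := by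
  have hw := contDiff_inv_norm_smul hf hQ
  rw [(hw.differentiable one_ne_zero).fderiv_norm_rpow hp]
  simp only [_root_.smul_apply, ContinuousLinearMap.comp_apply, innerSL_apply_apply,
    fderiv_inv_norm_smul_apply hQQ hf hQ, smul_eq_mul, inner_sub_right,
    real_inner_self_eq_norm_sq]
  set w := ‖Q x‖⁻¹ • f x
  have hd : ‖‖Q x‖⁻¹ • fderiv ℝ f x (Q x)‖ ≤ ‖fderiv ℝ f x‖ := by
    rw [norm_smul, norm_inv, norm_norm]
    by_cases h : ‖Q x‖ = 0
    · simp [h]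
    · rw [inv_mul_le_iff₀ (by positivity), mul_comm]
      exact (fderiv ℝ f x).le_opNorm _
  set D := ‖Q x‖⁻¹ • fderiv ℝ f x (Q x)
  have hin : -inner ℝ w D ≤ ‖w‖ * ‖fderiv ℝ f x‖ :=
    (neg_le_abs _).trans ((abs_real_inner_le_norm w D).trans (by gcongr))
  by_cases h0 : ‖w‖ = 0
  · rw [norm_eq_zero.1 h0]
    simp [Real.zero_rpow (by linarith : p ≠ 0), Real.zero_rpow (by linarith : p - 1 ≠ 0)]
  · have hpos : 0 < ‖w‖ := by positivity
    have e1 : ‖w‖ ^ (p - 1) = ‖w‖ ^ (p - 2) * ‖w‖ := by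
      rw [← Real.rpow_add_one h0]; ring_nf
    have e2 : ‖w‖ ^ p = ‖w‖ ^ (p - 2) * ‖w‖ ^ 2 := by
      rw [← Real.rpow_natCast ‖w‖ 2, ← Real.rpow_add hpos]; norm_num
    rw [e1, e2]
    have := mul_le_mul_of_nonneg_left hin (by positivity : 0 ≤ p * ‖w‖ ^ (p - 2))
    linarith

/-- Hardy's inequality for the distance to the kernel of a projection `Q`. -/
theorem hardy_inequality_of_projection {n : ℕ}
    {Q : EuclideanSpace ℝ (Fin n) →L[ℝ] EuclideanSpace ℝ (Fin n)} (hQQ : ∀ x, Q (Q x) = Q x)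
    {p : ℝ} (hp : 1 < p) (hpQ : p < ∑ j, Q (EuclideanSpace.single j 1) j)
    {f : EuclideanSpace ℝ (Fin n) → ℂ} (hf : ContDiff ℝ 1 f) (hfc : HasCompactSupport f)
    (hQ : ∀ x ∈ tsupport f, Q x ≠ 0) :
    (∫ x, ‖‖Q x‖⁻¹ • f x‖ ^ p) ^ (1 / p) ≤
      p / (∑ j, Q (EuclideanSpace.single j 1) j - p) * (∫ x, ‖fderiv ℝ f x‖ ^ p) ^ (1 / p) := by
  set τ := ∑ j, Q (EuclideanSpace.single j 1) j
  have hp0 : 0 < p := by linarith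
  have hτ : 0 < τ - p := by linarith
  have hpq : p.HolderConjugate (p / (p - 1)) := Real.HolderConjugate.conjExponent hp
  have hwC := contDiff_inv_norm_smul hf hQ
  have hwc : HasCompactSupport fun x => ‖Q x‖⁻¹ • f x :=
    hfc.of_eq_zero_imp fun x hx => by simp [hx]
  have hibp := integral_fderiv_apply_linear Q (hwC.norm_rpow hp)
    (hwc.of_eq_zero_imp fun x hx => by simp [hx, Real.zero_rpow hp0.ne'])
  have hpt := neg_fderiv_norm_rpow_inv_norm_smul_apply_le hQQ hp hf hQ
  set w := fun x => ‖Q x‖⁻¹ • f x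
  have hwv : ∀ x, ‖Q x‖⁻¹ • f x = w x := fun _ => rfl
  simp only [hwv] at hibp hpt ⊢
  have hdC : Continuous (fderiv ℝ f) := hf.continuous_fderiv one_ne_zero
  have hw1C : Continuous fun x => ‖w x‖ ^ (p - 1) :=
    hwC.continuous.norm.rpow_const fun _ => Or.inr (by linarith)
  have hw1c : HasCompactSupport fun x => ‖w x‖ ^ (p - 1) :=
    hwc.of_eq_zero_imp fun x hx => by simp [hx, Real.zero_rpow (by linarith : p - 1 ≠ 0)]
  have hGint : Integrable fun x => ‖w x‖ ^ p :=
    (hwC.norm_rpow hp).continuous.integrable_of_hasCompactSupport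
      (hwc.of_eq_zero_imp fun x hx => by simp [hx, Real.zero_rpow hp0.ne'])
  have hMint : Integrable fun x => ‖w x‖ ^ (p - 1) * ‖fderiv ℝ f x‖ :=
    (hw1C.mul hdC.norm).integrable_of_hasCompactSupport hw1c.mul_right
  have hLint : Integrable fun x => fderiv ℝ (fun x => ‖w x‖ ^ p) x (Q x) := by
    refine Continuous.integrable_of_hasCompactSupport
      (((hwC.norm_rpow hp).continuous_fderiv one_ne_zero).clm_apply Q.continuous) ?_
    have hc : HasCompactSupport fun x => ‖w x‖ ^ p :=
      hwc.of_eq_zero_imp fun x hx => by simp [hx, Real.zero_rpow hp0.ne']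
    exact (hc.fderiv ℝ).of_eq_zero_imp fun x hx => by simp [hx]
  have hle := integral_mono hLint.neg ((hMint.const_mul p).add (hGint.const_mul p)) hpt
  simp only [Pi.neg_apply, Pi.add_apply] at hle
  rw [integral_neg, hibp, integral_add (hMint.const_mul p) (hGint.const_mul p),
    integral_const_mul, integral_const_mul] at hle
  have hholder := integral_mul_le_Lp_mul_Lq_of_nonneg (μ := volume) hpq.symm
    (f := fun x => ‖w x‖ ^ (p - 1)) (g := fun x => ‖fderiv ℝ f x‖)
    (.of_forall fun x => by positivity) (.of_forall fun x => norm_nonneg _)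
    (hw1C.memLp_of_hasCompactSupport hw1c)
    (hdC.norm.memLp_of_hasCompactSupport (hfc.fderiv ℝ).norm)
  have hexp : ∀ x, (‖w x‖ ^ (p - 1)) ^ (p / (p - 1)) = ‖w x‖ ^ p := fun x => by
    rw [← Real.rpow_mul (norm_nonneg _), mul_div_cancel₀ _ (by linarith : p - 1 ≠ 0)]
  simp only [hexp] at hholder
  have hA : 0 ≤ ∫ x, ‖w x‖ ^ p := integral_nonneg fun x => by positivity
  have hB : 0 ≤ ∫ x, ‖fderiv ℝ f x‖ ^ p := integral_nonneg fun x => by positivity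
  set A := ∫ x, ‖w x‖ ^ p
  set B := ∫ x, ‖fderiv ℝ f x‖ ^ p
  rcases hA.eq_or_lt with hA0 | hA0
  · rw [← hA0, Real.zero_rpow (by positivity)]
    positivity
  · have hsplit : A = A ^ (1 / (p / (p - 1))) * A ^ (1 / p) := by
      rw [← Real.rpow_add hA0, one_div, one_div, hpq.symm.inv_add_inv_eq_one, Real.rpow_one]
    have hAq : 0 < A ^ (1 / (p / (p - 1))) := by positivity
    have hmain : A ^ (1 / (p / (p - 1))) * ((τ - p) * A ^ (1 / p)) ≤
        A ^ (1 / (p / (p - 1))) * (p * B ^ (1 / p)) := by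
      have h1 := mul_le_mul_of_nonneg_left hholder hp0.le
      calc _ = (τ - p) * A := by conv_rhs => rw [hsplit]
                                 ring
        _ ≤ _ := by linarith
    have := le_of_mul_le_mul_left hmain hAq
    rw [div_mul_eq_mul_div, le_div_iff₀ hτ]
    linarith

/-- Heisenberg–Pauli–Weyl type uncertainty principle on `ℝⁿ = ℝ^N × ℝ^{n-N}`. -/
theorem stmt7 (n N : ℕ) (hN : 2 ≤ N) (hNn : N ≤ n) (p : ℝ) (hp1 : 1 < p) (hpN : p < N)
    (f : EuclideanSpace ℝ (Fin n) → ℂ) (hf : ContDiff ℝ (⊤ : ℕ∞) f)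
    (hfc : HasCompactSupport f)
    (hfs : tsupport f ⊆ {x | ∃ i : Fin N, x (Fin.castLE hNn i) ≠ 0}) :
    ∫ x, ‖f x‖ ^ 2
      ≤ (p / ((N : ℝ) - p)) * (∫ x, ‖fderiv ℝ f x‖ ^ p) ^ (1 / p) *
        (∫ x, (sliceNorm N hNn x * ‖f x‖) ^ (p / (p - 1))) ^ ((p - 1) / p) := by
  have hp0 : 0 < p := by linarith
  have hpq : p.HolderConjugate (p / (p - 1)) := Real.HolderConjugate.conjExponent hp1
  have hf1 : ContDiff ℝ 1 f := hf.of_le (by exact_mod_cast le_top)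
  have hQ : ∀ x ∈ tsupport f, headProj n N x ≠ 0 := by
    intro x hx h0
    obtain ⟨i, hi⟩ := hfs hx
    have h := headProj_apply (N := N) x (Fin.castLE hNn i)
    rw [h0] at h
    simp at h
    exact hi h.symm
  have hhardy := hardy_inequality_of_projection headProj_headProj hp1
    (by rwa [trace_headProj hNn]) hf1 hfc hQ
  rw [trace_headProj hNn] at hhardy
  have hwC := contDiff_inv_norm_smul hf1 hQ
  have hwc : HasCompactSupport fun x => ‖headProj n N x‖⁻¹ • f x :=
    hfc.of_eq_zero_imp fun x hx => by simp [hx]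
  have hholder := integral_mul_le_Lp_mul_Lq_of_nonneg (μ := volume) hpq
    (f := fun x => ‖‖headProj n N x‖⁻¹ • f x‖) (g := fun x => ‖headProj n N x‖ * ‖f x‖)
    (.of_forall fun x => norm_nonneg _) (.of_forall fun x => by positivity)
    (hwC.continuous.norm.memLp_of_hasCompactSupport hwc.norm)
    (((headProj n N).continuous.norm.mul hf.continuous.norm).memLp_of_hasCompactSupport
      hfc.norm.mul_left)
  have hmul : ∀ x, ‖‖headProj n N x‖⁻¹ • f x‖ * (‖headProj n N x‖ * ‖f x‖) = ‖f x‖ ^ 2 := by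
    intro x
    by_cases hx : x ∈ tsupport f
    · have := norm_ne_zero_iff.2 (hQ x hx)
      rw [norm_smul, norm_inv, norm_norm]
      field_simp
    · simp [image_eq_zero_of_notMem_tsupport hx]
  simp only [hmul] at hholder
  simp only [norm_headProj hNn, one_div_div] at hholder hhardy
  exact hholder.trans (mul_le_mul_of_nonneg_right hhardy (by
    refine Real.rpow_nonneg (integral_nonneg fun x => ?_) _
    have : 0 ≤ sliceNorm N hNn x := Real.sqrt_nonneg _
    positivity))
end

section
/- Let n ≥ 2, let Ω ⊂ ℝⁿ be a bounded open set with 0 ∈ Ω, and set R = sup_{x∈Ω} ‖x‖. Let g : (1,∞) → ℝ be a C² function with g′(t) < 0 and g″(t) > 0 for all t > 1, and suppose there is a constant C with (−g′(t))^{2(n−1)} / (g″(t))^{n−1} ≤ C < ∞ for all t > 1. Then for every real-valued f ∈ C_0^∞(Ω \ {0}) whose support is contained in {x : ‖x‖ < R}, one has ((n−1)/n)^n ∫_Ω (|f(x)|^n / ‖x‖^n) (−g′(log(Re/‖x‖)))^{n−2} g″(log(Re/‖x‖)) dx ≤ ∫_Ω [(−g′(log(Re/‖x‖)))^{2(n−1)}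 / (g″(log(Re/‖x‖)))^{n−1}] |⟨x/‖x‖, ∇f(x)⟩|^n dx, where e is the base of the natural logarithm (so log(Re/‖x‖) = 1 + log(R/‖x‖) > 1 on the support of f). -/
open MeasureTheory

/-- The divergence of `x ↦ F x • x` integrates to zero when `F` is `C¹` with compact support. -/
theorem integral_fderiv_self_add_mul_eq_zero {n : ℕ} {F : EuclideanSpace ℝ (Fin n) → ℝ}
    (hF : ContDiff ℝ 1 F) (hFc : HasCompactSupport F) :
    Integrable (fun x => fderiv ℝ F x x + n * F x) ∧
      ∫ x, (fderiv ℝ F x x + n * F x) = 0 := by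
  let e : Fin n → EuclideanSpace ℝ (Fin n) := fun i => EuclideanSpace.single i 1
  have hD : ∀ v, Continuous fun x => fderiv ℝ F x v := fun v =>
    (hF.continuous_fderiv one_ne_zero).clm_apply continuous_const
  have hcoord : ∀ i x, fderiv ℝ (fun y : EuclideanSpace ℝ (Fin n) => y i) x (e i) = 1 := by
    intro i x
    have h : HasFDerivAt (fun y : EuclideanSpace ℝ (Fin n) => y i)
      (EuclideanSpace.proj i : EuclideanSpace ℝ (Fin n) →L[ℝ] ℝ) x :=
      (EuclideanSpace.proj i : EuclideanSpace ℝ (Fin n) →L[ℝ] ℝ).hasFDerivAt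
    simp [h.fderiv, e]
  have hi1 : Integrable F := hF.continuous.integrable_of_hasCompactSupport hFc
  have hi2 : ∀ i, Integrable fun x => x i * fderiv ℝ F x (e i) := fun i =>
    Continuous.integrable_of_hasCompactSupport (by have := hD (e i); fun_prop)
      ((hFc.fderiv_apply ℝ (e i)).mul_left)
  have hi3 : ∀ i, Integrable fun x => x i * F x := fun i =>
    Continuous.integrable_of_hasCompactSupport (by have := hF.continuous; fun_prop) hFc.mul_left
  have hparts : ∀ i, ∫ x, x i * fderiv ℝ F x (e i) = -∫ x, F x := by
    intro i
    have := integral_mul_fderiv_eq_neg_fderiv_mul_of_integrable (μ := volume)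
      (f := fun x : EuclideanSpace ℝ (Fin n) => x i) (g := F) (v := e i)
      (by simpa [hcoord] using hi1) (hi2 i) (hi3 i)
      (fun x _ => by fun_prop) (fun x _ => (hF.differentiable one_ne_zero) x)
    simpa [hcoord] using this
  have hsum : ∀ x, fderiv ℝ F x x = ∑ i, x i * fderiv ℝ F x (e i) := by
    intro x
    have := congrArg (fderiv ℝ F x) ((EuclideanSpace.basisFun (Fin n) ℝ).sum_repr x)
    simpa [map_sum, e] using this.symm
  simp_rw [hsum]
  have hiS : Integrable fun x : EuclideanSpace ℝ (Fin n) => ∑ i, x i * fderiv ℝ F x (e i) :=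
    integrable_finsetSum _ fun i _ => hi2 i
  refine ⟨hiS.add (hi1.const_mul _), ?_⟩
  rw [integral_add hiS (hi1.const_mul _), integral_finsetSum _ fun i _ => hi2 i,
    integral_const_mul]
  simp [hparts]

theorem hasDerivAt_abs_pow (m : ℕ) (y : ℝ) :
    HasDerivAt (fun y : ℝ => |y| ^ (m + 2)) ((m + 2) * |y| ^ m * y) y := by
  have h := hasDerivAt_abs_rpow y (p := (m : ℝ) + 2) (by linarith [m.cast_nonneg (α := ℝ)])
  have e : ∀ z : ℝ, z ^ ((m : ℝ) + 2) = z ^ (m + 2) := fun z => by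
    rw [← Real.rpow_natCast]; push_cast; rfl
  simpa [e] using h

theorem contDiff_abs_pow (m : ℕ) : ContDiff ℝ 1 (fun y : ℝ => |y| ^ (m + 2)) := by
  have h := contDiff_norm_rpow (E := ℝ) (p := (m : ℝ) + 2)
    (by linarith [m.cast_nonneg (α := ℝ)])
  have e : ∀ z : ℝ, z ^ ((m : ℝ) + 2) = z ^ (m + 2) := fun z => by
    rw [← Real.rpow_natCast]; push_cast; rfl
  simpa [e] using h

/-- Young's inequality with natural exponents. -/
theorem mul_pow_mul_le_add_pow (m : ℕ) {u v : ℝ} (hu : 0 ≤ u) (hv : 0 ≤ v) :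
    ((m : ℝ) + 2) * (u ^ (m + 1) * v) ≤ (m + 1) * u ^ (m + 2) + v ^ (m + 2) := by
  rcases hu.eq_or_lt with rfl | hu
  · simp; positivity
  have hB := one_add_mul_le_pow (a := v / u - 1) (by linarith [div_nonneg hv hu.le]) (m + 2)
  have hp : 0 < u ^ (m + 2) := by positivity
  have := mul_le_mul_of_nonneg_left hB hp.le
  rw [add_sub_cancel, ← mul_pow, mul_div_cancel₀ v hu.ne'] at this
  have e : u ^ (m + 2) * (v / u) = u ^ (m + 1) * v := by
    field_simp
    ring
  push_cast at this
  linear_combination this - ((m : ℝ) + 2) * e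

/-- The pointwise inequality behind the Hardy inequality: `h`, `q` stand for `-g'`, `g''`,
`d` for `⟨x, ∇f⟩`, and the last summand is a divergence. -/
theorem hardy_pointwise (m : ℕ) {h q r : ℝ} (a d : ℝ) (hh : 0 < h) (hq : 0 < q) (hr : 0 < r) :
    (((m : ℝ) + 1) / (m + 2)) ^ (m + 2) * ((|a| ^ (m + 2) / r ^ (m + 2)) * h ^ m * q) ≤
      (h ^ (2 * (m + 1)) / q ^ (m + 1)) * |r⁻¹ * d| ^ (m + 2) +
        (((m : ℝ) + 1) / (m + 2)) ^ (m + 1) *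
          (((m + 1) * h ^ m * q * |a| ^ (m + 2) + h ^ (m + 1) * ((m + 2) * |a| ^ m * a * d)) /
            r ^ (m + 2)) := by
  set c : ℝ := ((m : ℝ) + 1) / (m + 2) with hc
  have hc0 : 0 < c := by positivity
  have hcm : ((m : ℝ) + 2) * c = m + 1 := by rw [hc]; field_simp
  clear_value c
  have hY := mul_pow_mul_le_add_pow m (u := c * |a|) (v := |d| * h / q)
    (by positivity) (by positivity)
  have hW := mul_le_mul_of_nonneg_left hY (show 0 ≤ h ^ m * q by positivity)
  have hV : h ^ m * q * (|d| * h / q) ^ (m + 2) =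
      h ^ (2 * (m + 1)) / q ^ (m + 1) * |d| ^ (m + 2) := by
    rw [div_pow, mul_pow]
    field_simp
    ring
  have hX : h ^ m * q * ((c * |a|) ^ (m + 1) * (|d| * h / q)) =
      c ^ (m + 1) * (h ^ (m + 1) * (|a| ^ (m + 1) * |d|)) := by
    field_simp
    ring
  have hs : -(|a| ^ (m + 1) * |d|) ≤ |a| ^ m * a * d := by
    have := neg_abs_le (|a| ^ m * a * d)
    rwa [abs_mul, abs_mul, abs_pow, abs_abs, ← pow_succ] at this
  have hs' := mul_le_mul_of_nonneg_left hs
    (show 0 ≤ ((m : ℝ) + 2) * c ^ (m + 1) * h ^ (m + 1) by positivity)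
  have key : c ^ (m + 2) * (|a| ^ (m + 2) * h ^ m * q) ≤
      (h ^ (2 * (m + 1)) / q ^ (m + 1)) * |d| ^ (m + 2) + c ^ (m + 1) *
        ((m + 1) * h ^ m * q * |a| ^ (m + 2) + h ^ (m + 1) * ((m + 2) * |a| ^ m * a * d)) := by
    rw [mul_add (h ^ m * q), hV] at hW
    linear_combination hW + hs' - ((m : ℝ) + 2) * hX +
      c ^ (m + 1) * |a| ^ (m + 2) * h ^ m * q * hcm
  have hdiv := div_le_div_of_nonneg_right key (show 0 ≤ r ^ (m + 2) by positivity)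
  rw [abs_mul, abs_inv, abs_of_pos hr, mul_pow, inv_pow]
  refine (le_of_eq ?_).trans (hdiv.trans (le_of_eq ?_)) <;> ring

theorem Real.one_lt_log_mul_exp_one_div {R r : ℝ} (hr : 0 < r) (hR : r < R) :
    1 < Real.log (R * Real.exp 1 / r) := by
  rw [Real.lt_log_iff_exp_lt (by have := hr.trans hR; positivity), lt_div_iff₀ hr, mul_comm]
  gcongr

/-- The radial derivative of the function whose radial divergence enters the pointwise
inequality. -/
theorem fderiv_radial_weight_self {E : Type*} [NormedAddCommGroup E] [InnerProductSpace ℝ E]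
    (m : ℕ) {R : ℝ} {h : ℝ → ℝ} {f : E → ℝ} {x : E} {q : ℝ} (hx : x ≠ 0) (hR : 0 < R)
    (hh : HasDerivAt h (-q) (Real.log (R * Real.exp 1 / ‖x‖))) (hf : DifferentiableAt ℝ f x)
    (hF : DifferentiableAt ℝ (fun y => h (Real.log (R * Real.exp 1 / ‖y‖)) ^ (m + 1) *
      |f y| ^ (m + 2) * ‖y‖⁻¹ ^ (m + 2)) x) :
    fderiv ℝ (fun y => h (Real.log (R * Real.exp 1 / ‖y‖)) ^ (m + 1) *
        |f y| ^ (m + 2) * ‖y‖⁻¹ ^ (m + 2)) x x +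
      (m + 2) * (h (Real.log (R * Real.exp 1 / ‖x‖)) ^ (m + 1) *
        |f x| ^ (m + 2) * ‖x‖⁻¹ ^ (m + 2)) =
    ((m + 1) * h (Real.log (R * Real.exp 1 / ‖x‖)) ^ m * q * |f x| ^ (m + 2) +
      h (Real.log (R * Real.exp 1 / ‖x‖)) ^ (m + 1) *
        ((m + 2) * |f x| ^ m * f x * fderiv ℝ f x x)) / ‖x‖ ^ (m + 2) := by
  have hx0 : 0 < ‖x‖ := norm_pos_iff.2 hx
  set T := Real.log (R * Real.exp 1 / ‖x‖) with hT
  have hline : HasDerivAt (fun s : ℝ => s • x) x 1 := by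
    simpa using (hasDerivAt_id (1 : ℝ)).smul_const x
  have hf1 : HasDerivAt (fun s : ℝ => f (s • x)) (fderiv ℝ f x x) 1 :=
    HasFDerivAt.comp_hasDerivAt (1 : ℝ) (by simpa using hf.hasFDerivAt) hline
  have hF1 := HasFDerivAt.comp_hasDerivAt (1 : ℝ) (f := fun s : ℝ => s • x)
    (by rw [one_smul]; exact hF.hasFDerivAt) hline
  have hh1 : HasDerivAt (fun s : ℝ => h (T - Real.log s)) q 1 := by
    have hlog : HasDerivAt (fun s : ℝ => T - Real.log s) (-1) 1 := by
      simpa using (Real.hasDerivAt_log one_ne_zero).const_sub T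
    have := HasDerivAt.comp (1 : ℝ) (h₂ := h) (by simpa using hh) hlog
    simpa [Function.comp_def] using this
  have ha1 : HasDerivAt (fun s : ℝ => |f (s • x)| ^ (m + 2))
      ((m + 2) * |f x| ^ m * f x * fderiv ℝ f x x) 1 :=
    HasDerivAt.comp (1 : ℝ) (h₂ := fun y : ℝ => |y| ^ (m + 2))
      (by simpa using hasDerivAt_abs_pow m (f x)) hf1
  have hr1 : HasDerivAt (fun s : ℝ => (s⁻¹ * ‖x‖⁻¹) ^ (m + 2))
      (-((m + 2) * ‖x‖⁻¹ ^ (m + 2))) 1 := by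
    have := ((hasDerivAt_inv (one_ne_zero (α := ℝ))).mul_const ‖x‖⁻¹).pow (m + 2)
    exact this.congr_deriv (by push_cast; simp [pow_succ]; ring)
  have hprod := ((hh1.pow (m + 1)).mul ha1).mul hr1
  have heq : (fun s : ℝ => h (Real.log (R * Real.exp 1 / ‖s • x‖)) ^ (m + 1) *
        |f (s • x)| ^ (m + 2) * ‖s • x‖⁻¹ ^ (m + 2)) =ᶠ[nhds 1]
      fun s => h (T - Real.log s) ^ (m + 1) * |f (s • x)| ^ (m + 2) *
        (s⁻¹ * ‖x‖⁻¹) ^ (m + 2) := by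
    filter_upwards [lt_mem_nhds (zero_lt_one (α := ℝ))] with s hs
    have e : R * Real.exp 1 / ‖s • x‖ = R * Real.exp 1 / ‖x‖ / s := by
      rw [norm_smul, Real.norm_of_nonneg hs.le, div_div, mul_comm s]
    rw [e, Real.log_div (by positivity) hs.ne', norm_smul, Real.norm_of_nonneg hs.le, mul_inv]
  rw [hF1.unique (hprod.congr_of_eventuallyEq heq)]
  simp [pow_succ]
  field_simp
  ring

theorem tsupport_subset_tsupport_of_eq_zero {X : Type*} [TopologicalSpace X] {f F : X → ℝ}
    (h0 : ∀ x ∉ tsupport f, F x = 0) : tsupport F ⊆ tsupport f :=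
  closure_minimal (fun x hx => by_contra fun hxf => hx (h0 x hxf)) (isClosed_tsupport f)

theorem contDiff_of_tsupport {E : Type*} [NormedAddCommGroup E] [NormedSpace ℝ E]
    {k : WithTop ℕ∞} {F : E → ℝ} (hF : ∀ x ∈ tsupport F, ContDiffAt ℝ k F x) :
    ContDiff ℝ k F :=
  contDiff_iff_contDiffAt.2 fun x => (em (x ∈ tsupport F)).elim (hF x) fun hx =>
    (contDiffAt_const (c := (0 : ℝ))).congr_of_eventuallyEq
      (notMem_tsupport_iff_eventuallyEq.1 hx)

/-- Abstract critical Hardy type inequality on a bounded domain `Ω ⊂ ℝⁿ`, with an auxiliary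
convex decreasing `C²` function `g` on `(1, ∞)`. -/
theorem stmt10 (n : ℕ) (hn : 2 ≤ n) (Ω : Set (EuclideanSpace ℝ (Fin n)))
    (hΩo : IsOpen Ω) (hΩb : Bornology.IsBounded Ω)
    (h0 : (0 : EuclideanSpace ℝ (Fin n)) ∈ Ω)
    (R : ℝ) (hR : R = sSup ((fun x => ‖x‖) '' Ω))
    (g : ℝ → ℝ) (hg : ContDiffOn ℝ 2 g (Set.Ioi (1 : ℝ)))
    (hg' : ∀ t > (1 : ℝ), deriv g t < 0)
    (hg'' : ∀ t > (1 : ℝ), 0 < deriv (deriv g) t)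
    (hgC : ∃ C : ℝ, ∀ t > (1 : ℝ),
      (-deriv g t) ^ (2 * (n - 1)) / (deriv (deriv g) t) ^ (n - 1) ≤ C)
    (f : EuclideanSpace ℝ (Fin n) → ℝ) (hf : ContDiff ℝ (⊤ : ℕ∞) f)
    (hfc : HasCompactSupport f)
    (hfs : tsupport f ⊆ Ω \ {0}) (hfs' : tsupport f ⊆ {x | ‖x‖ < R}) :
    (((n : ℝ) - 1) / n) ^ n *
        ∫ x in Ω, (|f x| ^ n / ‖x‖ ^ n) *
          (-deriv g (Real.log (R * Real.exp 1 / ‖x‖))) ^ (n - 2) *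
          deriv (deriv g) (Real.log (R * Real.exp 1 / ‖x‖))
      ≤ ∫ x in Ω,
          ((-deriv g (Real.log (R * Real.exp 1 / ‖x‖))) ^ (2 * (n - 1)) /
              (deriv (deriv g) (Real.log (R * Real.exp 1 / ‖x‖))) ^ (n - 1)) *
            |fderiv ℝ f x ((‖x‖)⁻¹ • x)| ^ n := by
  obtain ⟨m, rfl⟩ : ∃ m, n = m + 2 := ⟨n - 2, by omega⟩
  have hf1 : ContDiff ℝ 1 f := contDiff_infty.1 hf 1
  have hx0 : ∀ x ∈ tsupport f, x ≠ 0 := fun x hx => (hfs hx).2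
  have ht : ∀ x ∈ tsupport f, 1 < Real.log (R * Real.exp 1 / ‖x‖) := fun x hx =>
    Real.one_lt_log_mul_exp_one_div (norm_pos_iff.2 (hx0 x hx)) (hfs' hx)
  have hRpos : ∀ x ∈ tsupport f, 0 < R := fun x hx =>
    (norm_pos_iff.2 (hx0 x hx)).trans (hfs' hx)
  have hg1 : ContDiffOn ℝ 1 (deriv g) (Set.Ioi 1) :=
    hg.deriv_of_isOpen isOpen_Ioi (by norm_num)
  have hg2 : ContDiffOn ℝ 0 (deriv (deriv g)) (Set.Ioi 1) :=
    hg1.deriv_of_isOpen isOpen_Ioi (by norm_num)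
  have hT : ∀ x ∈ tsupport f,
      ContDiffAt ℝ 1 (fun y : EuclideanSpace ℝ (Fin (m + 2)) =>
        Real.log (R * Real.exp 1 / ‖y‖)) x := by
    intro x hx
    have hn0 : 0 < ‖x‖ := norm_pos_iff.2 (hx0 x hx)
    have := hRpos x hx
    exact (contDiffAt_const.div (contDiffAt_norm ℝ (hx0 x hx)) hn0.ne').log
      (div_pos (mul_pos this (Real.exp_pos 1)) hn0).ne'
  have hdT : ∀ x ∈ tsupport f,
      ContDiffAt ℝ 1 (fun y : EuclideanSpace ℝ (Fin (m + 2)) =>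
        deriv g (Real.log (R * Real.exp 1 / ‖y‖))) x :=
    fun x hx => ContDiffAt.comp x (hg1.contDiffAt (Ioi_mem_nhds (ht x hx))) (hT x hx)
  have hqT : ∀ x ∈ tsupport f,
      ContDiffAt ℝ 0 (fun y : EuclideanSpace ℝ (Fin (m + 2)) =>
        deriv (deriv g) (Real.log (R * Real.exp 1 / ‖y‖))) x :=
    fun x hx => ContDiffAt.comp x (hg2.contDiffAt (Ioi_mem_nhds (ht x hx)))
      ((hT x hx).of_le zero_le_one)
  have hf0 : ∀ x ∉ tsupport f, f x = 0 := fun x hx => image_eq_zero_of_notMem_tsupport hx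
  have hd0 : ∀ x ∉ tsupport f, fderiv ℝ f x = 0 := fun x hx => fderiv_of_notMem_tsupport ℝ hx
  set F : EuclideanSpace ℝ (Fin (m + 2)) → ℝ := fun y =>
    (-deriv g (Real.log (R * Real.exp 1 / ‖y‖))) ^ (m + 1) *
    |f y| ^ (m + 2) * ‖y‖⁻¹ ^ (m + 2) with hFdef
  have hF0 : ∀ x ∉ tsupport f, F x = 0 := fun x hx => by simp [hFdef, hf0 x hx]
  have hF : ContDiff ℝ 1 F := contDiff_of_tsupport fun x hxF => by
    have hx := tsupport_subset_tsupport_of_eq_zero hF0 hxF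
    exact (((hdT x hx).neg.pow _).mul ((contDiff_abs_pow m).comp hf1).contDiffAt).mul
      (((contDiffAt_norm ℝ (hx0 x hx)).inv (norm_ne_zero_iff.2 (hx0 x hx))).pow _)
  have hFc : HasCompactSupport F := HasCompactSupport.intro hfc hF0
  obtain ⟨hdivi, hdiv⟩ := integral_fderiv_self_add_mul_eq_zero hF hFc
  set A : EuclideanSpace ℝ (Fin (m + 2)) → ℝ := fun x => (|f x| ^ (m + 2) / ‖x‖ ^ (m + 2)) *
    (-deriv g (Real.log (R * Real.exp 1 / ‖x‖))) ^ (m + 2 - 2) *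
    deriv (deriv g) (Real.log (R * Real.exp 1 / ‖x‖)) with hA
  set B : EuclideanSpace ℝ (Fin (m + 2)) → ℝ := fun x =>
    ((-deriv g (Real.log (R * Real.exp 1 / ‖x‖))) ^ (2 * (m + 2 - 1)) /
    (deriv (deriv g) (Real.log (R * Real.exp 1 / ‖x‖))) ^ (m + 2 - 1)) *
    |fderiv ℝ f x ((‖x‖)⁻¹ • x)| ^ (m + 2) with hB
  have hA0 : ∀ x ∉ tsupport f, A x = 0 := fun x hx => by simp [hA, hf0 x hx]
  have hB0 : ∀ x ∉ tsupport f, B x = 0 := fun x hx => by simp [hB, hd0 x hx]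
  have hAc : Continuous A := continuous_of_tsupport fun x hxA => by
    have hx := tsupport_subset_tsupport_of_eq_zero hA0 hxA
    have hn0 : ‖x‖ ^ (m + 2) ≠ 0 := pow_ne_zero _ (norm_ne_zero_iff.2 (hx0 x hx))
    exact (((hf1.continuous.continuousAt.abs.pow _).div (continuousAt_id.norm.pow _) hn0).mul
      ((hdT x hx).continuousAt.neg.pow _)).mul (hqT x hx).continuousAt
  have hBc : Continuous B := continuous_of_tsupport fun x hxB => by
    have hx := tsupport_subset_tsupport_of_eq_zero hB0 hxB
    have hn0 : ‖x‖ ≠ 0 := norm_ne_zero_iff.2 (hx0 x hx)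
    exact (((hdT x hx).continuousAt.neg.pow _).div ((hqT x hx).continuousAt.pow _)
      (pow_ne_zero _ (hg'' _ (ht x hx)).ne')).mul
      ((((hf1.continuous_fderiv one_ne_zero).continuousAt.clm_apply
        ((continuousAt_id.norm.inv₀ hn0).smul continuousAt_id)).abs).pow _)
  have hAi : Integrable A :=
    hAc.integrable_of_hasCompactSupport (HasCompactSupport.intro hfc hA0)
  have hBi : Integrable B :=
    hBc.integrable_of_hasCompactSupport (HasCompactSupport.intro hfc hB0)
  have hsub : ∀ x ∉ Ω, x ∉ tsupport f := fun x hx h => hx (hfs h).1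
  rw [setIntegral_eq_integral_of_forall_compl_eq_zero fun x hx => hA0 x (hsub x hx),
    setIntegral_eq_integral_of_forall_compl_eq_zero fun x hx => hB0 x (hsub x hx)]
  have hle : ∀ x, (((m : ℝ) + 1) / (m + 2)) ^ (m + 2) * A x ≤
      B x + (((m : ℝ) + 1) / (m + 2)) ^ (m + 1) *
        (fderiv ℝ F x x + (m + 2 : ℕ) * F x) := by
    intro x
    by_cases hx : x ∈ tsupport f
    · have hh : HasDerivAt (fun t => -deriv g t)
          (-deriv (deriv g) (Real.log (R * Real.exp 1 / ‖x‖)))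
          (Real.log (R * Real.exp 1 / ‖x‖)) :=
        (((hg1.contDiffAt (Ioi_mem_nhds (ht x hx))).differentiableAt
          one_ne_zero).hasDerivAt).neg
      have hrad := fderiv_radial_weight_self m (hx0 x hx) (hRpos x hx) hh
        (hf1.differentiable one_ne_zero x) (hF.differentiable one_ne_zero x)
      have hpt := hardy_pointwise m (f x) (fderiv ℝ f x x) (neg_pos.2 (hg' _ (ht x hx)))
        (hg'' _ (ht x hx)) (norm_pos_iff.2 (hx0 x hx))
      rw [← hrad] at hpt
      simpa [hA, hB, hFdef] using hpt
    · have hFx : fderiv ℝ F x = 0 := fderiv_of_notMem_tsupport ℝ fun h =>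
        hx (tsupport_subset_tsupport_of_eq_zero hF0 h)
      simp [hA0 x hx, hB0 x hx, hF0 x hx, hFx]
  have hint := integral_mono (hAi.const_mul _) (hBi.add (hdivi.const_mul _)) hle
  simp only [Pi.add_apply] at hint
  rw [integral_add hBi (hdivi.const_mul _), integral_const_mul, integral_const_mul, hdiv,
    mul_zero, add_zero] at hint
  have hc : ((m + 2 : ℕ) : ℝ) - 1 = m + 1 := by push_cast; ring
  rw [hc]
  exact_mod_cast hint
end
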